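/- arXiv:2007.09821 — 4 statements merged into one kernel-verified Lean document; each statement's English description precedes it below -/
import Mathlib

section
/- Fix integers q ≥ 1 and 0 ≤ r < s, and let e_k^+ = E_k((x+r)/q) + E_k((x+s)/q). Then for all m ≥ 0, H_{2m}(e_k^+) = (−1)^m · (2^{2m+1}/(m!)^2) · Π_{ℓ=1}^{m} ( (ℓ^2/4)(((s−r)/q)^2 − (2ℓ−1)^2) )^{2(m+1−ℓ)}, and H_{2m+1}(e_k^+) = Π_{ℓ=0}^{m} ( (ℓ!)^4 / 16^ℓ ) · ( ((s−r)/q)^2 − (2ℓ+1)^2 )^{2(m−ℓ)+1}. -/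
/-- The `n`-th Hankel determinant of a sequence `c`. -/
noncomputable def hankel {R : Type*} [CommRing R] (c : ℕ → R) (n : ℕ) : R :=
  (Matrix.of fun i j : Fin (n + 1) => c (i.1 + j.1)).det

/-- The `n`-th Euler polynomial, evaluated at `x`, via
`E_n(x) = (2/(n+1)) (B_{n+1}(x) - 2^{n+1} B_{n+1}(x/2))`. -/
noncomputable def eulerPoly (n : ℕ) (x : ℚ) : ℚ :=
  (2 / (n + 1)) *
    ((Polynomial.bernoulli (n + 1)).eval x - 2 ^ (n + 1) * (Polynomial.bernoulli (n + 1)).eval (x / 2))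

open Polynomial in
/-- A rational polynomial with a nonzero period is constant. -/
theorem Polynomial.eq_C_of_eval_add_eq {p : ℚ[X]} {t : ℚ} (ht : t ≠ 0)
    (h : ∀ y, p.eval (y + t) = p.eval y) : p = C (p.eval 0) := by
  have hk : ∀ k : ℕ, p.eval (k * t) = p.eval 0 := by
    intro k
    induction k with
    | zero => simp
    | succ k ih => rw [← ih, ← h (k * t)]; push_cast; ring_nf
  refine Polynomial.eq_of_infinite_eval_eq _ _ (Set.Infinite.mono ?_
    (Set.infinite_range_of_injective (f := fun k : ℕ => (k : ℚ) * t) fun i j hij => ?_))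
  · rintro _ ⟨k, rfl⟩
    simpa using hk k
  · simpa [ht] using hij

open Polynomial in
/-- The duplication formula for Bernoulli polynomials. -/
theorem bernoulli_eval_two_mul (n : ℕ) (y : ℚ) :
    2 * (Polynomial.bernoulli n).eval (2 * y)
      = 2 ^ n * ((Polynomial.bernoulli n).eval y + (Polynomial.bernoulli n).eval (y + 1 / 2)) := by
  let D : ℕ → ℚ[X] := fun n => 2 * (Polynomial.bernoulli n).comp (2 * X)
    - 2 ^ n * (Polynomial.bernoulli n + (Polynomial.bernoulli n).comp (X + C (1 / 2)))
  have hev : ∀ n y, (D n).eval y = 2 * (Polynomial.bernoulli n).eval (2 * y)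
      - 2 ^ n * ((Polynomial.bernoulli n).eval y
        + (Polynomial.bernoulli n).eval (y + 1 / 2)) := by
    intro n y
    simp [D]
  have hder : derivative (D (n + 1)) = (2 * (n + 1) : ℚ[X]) * D n := by
    have h2 : derivative (2 ^ (n + 1) : ℚ[X]) = 0 := by
      exact_mod_cast derivative_natCast (R := ℚ) (n := 2 ^ (n + 1))
    simp [D, derivative_comp, derivative_bernoulli_add_one, h2]
    ring
  have hconst : D (n + 1) = C ((D (n + 1)).eval 0) := by
    refine Polynomial.eq_C_of_eval_add_eq (t := 1 / 2) (by norm_num) fun y => ?_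
    have h1 := Polynomial.bernoulli_eval_one_add (n + 1) (2 * y)
    have h2 := Polynomial.bernoulli_eval_one_add (n + 1) y
    rw [hev, hev, show 2 * (y + 1 / 2) = 1 + 2 * y by ring,
      show y + 1 / 2 + 1 / 2 = 1 + y by ring, h1, h2]
    simp only [Nat.add_sub_cancel]
    ring
  have hzero : D n = 0 := by
    rw [hconst, derivative_C] at hder
    have hne : (2 * (n + 1) : ℚ[X]) ≠ 0 := by
      have := Nat.cast_ne_zero (R := ℚ[X]).mpr (by omega : 2 * (n + 1) ≠ 0)
      push_cast at this
      exact this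
    simpa [hne] using hder.symm
  have := hev n y
  rw [hzero, eval_zero] at this
  linarith

theorem eulerPoly_add_one_add (n : ℕ) (x : ℚ) :
    eulerPoly n (x + 1) + eulerPoly n x = 2 * x ^ n := by
  have h1 := bernoulli_eval_two_mul (n + 1) (x / 2)
  have h2 := Polynomial.bernoulli_eval_one_add (n + 1) x
  rw [mul_div_cancel₀ x two_ne_zero] at h1
  have hn : 2 / (n + 1 : ℚ) * (n + 1) = 2 := div_mul_cancel₀ _ (by positivity)
  rw [eulerPoly, eulerPoly, add_comm x 1, h2, show (1 + x) / 2 = x / 2 + 1 / 2 by ring]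
  push_cast [Nat.add_sub_cancel] at *
  linear_combination (2 / (n + 1) : ℚ) * h1 + x ^ n * hn

open Polynomial in
/-- The addition formula of an Appell sequence of polynomials. -/
theorem appell_eval_add {A : ℕ → ℚ[X]} (h0 : derivative (A 0) = 0)
    (hA : ∀ n : ℕ, derivative (A (n + 1)) = (n + 1 : ℚ[X]) * A n) (n : ℕ) (y t : ℚ) :
    (A n).eval (y + t)
      = ∑ j ∈ Finset.range (n + 1), (n.choose j : ℚ) * (A j).eval y * t ^ (n - j) := by
  let D : ℕ → ℚ[X] := fun n => (A n).comp (C y + X)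
    - ∑ j ∈ Finset.range (n + 1), C ((n.choose j : ℚ) * (A j).eval y) * X ^ (n - j)
  have hroot : ∀ n, (D n).eval 0 = 0 := by
    intro n
    simp only [D, eval_sub, eval_comp, eval_add, eval_C, eval_X, add_zero, eval_finsetSum,
      eval_mul, eval_pow]
    rw [Finset.sum_range_succ, Finset.sum_eq_zero]
    · simp
    · intro j hj
      rw [zero_pow (by have := Finset.mem_range.1 hj; omega), mul_zero]
  have hder : ∀ n, derivative (D (n + 1)) = (n + 1 : ℚ[X]) * D n := by
    intro n
    simp only [D, derivative_sub, derivative_comp, hA, derivative_sum, derivative_C_mul_X_pow]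
    rw [Finset.sum_range_succ, mul_sub, Finset.mul_sum]
    congr 1
    · simp
    · simp only [Nat.sub_self, Nat.cast_zero, mul_zero, C_0, zero_mul, add_zero]
      refine Finset.sum_congr rfl fun j hj => ?_
      have hj' : j ≤ n := Nat.lt_succ_iff.1 (Finset.mem_range.1 hj)
      have hc : ((n + 1).choose j : ℚ) * ((n + 1 - j : ℕ) : ℚ) = (n + 1) * n.choose j := by
        have := Nat.choose_mul_succ_eq n j
        rw [mul_comm ((n : ℚ) + 1)]
        exact_mod_cast this.symm
      rw [show ((n : ℚ[X]) + 1) = C (n + 1 : ℚ) by simp, ← mul_assoc, ← C_mul,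
        show n + 1 - j - 1 = n - j by omega]
      congr 2
      linear_combination (A j).eval y * hc
  have hzero : ∀ n, D n = 0 := by
    intro n
    have hd : derivative (D n) = 0 := by
      induction n with
      | zero => simp [D, derivative_comp, h0]
      | succ n ih =>
        have := eq_C_of_derivative_eq_zero ih
        rw [coeff_zero_eq_eval_zero, hroot, C_0] at this
        rw [hder, this, mul_zero]
    have := eq_C_of_derivative_eq_zero hd
    rwa [coeff_zero_eq_eval_zero, hroot, C_0] at this
  have := congrArg (eval t) (hzero n)
  simp only [D, eval_sub, eval_comp, eval_add, eval_C, eval_X, eval_finsetSum,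
    eval_mul, eval_pow, eval_zero] at this
  linarith

open Polynomial in
theorem eulerPoly_eval_add (n : ℕ) (y t : ℚ) :
    eulerPoly n (y + t)
      = ∑ j ∈ Finset.range (n + 1), (n.choose j : ℚ) * eulerPoly j y * t ^ (n - j) := by
  let A : ℕ → ℚ[X] := fun n => C (2 / (n + 1) : ℚ) * (Polynomial.bernoulli (n + 1)
    - C (2 ^ (n + 1) : ℚ) * (Polynomial.bernoulli (n + 1)).comp (C (1 / 2) * X))
  have hev : ∀ n y, (A n).eval y = eulerPoly n y := by
    intro n y
    simp only [A, eulerPoly, eval_mul, eval_sub, eval_C, eval_comp, eval_X]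
    ring_nf
  have hder : ∀ n : ℕ, derivative (A (n + 1)) = (n + 1 : ℚ[X]) * A n := by
    intro n
    refine Polynomial.funext fun z => ?_
    have h1 : (n + 1 : ℚ) ≠ 0 := by positivity
    have h2 : (n + 1 + 1 : ℚ) ≠ 0 := by positivity
    simp only [A, derivative_C_mul, derivative_sub, derivative_comp, derivative_bernoulli_add_one,
      derivative_X, eval_mul, eval_sub, eval_C, eval_comp, eval_X, eval_add, eval_natCast,
      eval_one, mul_one]
    push_cast
    field_simp
    ring
  have h0 : derivative (A 0) = 0 := by
    refine Polynomial.funext fun z => ?_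
    simp [A]
  simpa only [hev] using appell_eval_add h0 hder n y t

section JFraction

open Polynomial

variable {R : Type*} [CommRing R]

/-- The monic polynomials with three-term recurrence
`P (n + 2) = (X - c) P (n + 1) - α n P n`. -/
noncomputable def jPoly (c : R) (α : ℕ → R) : ℕ → R[X]
  | 0 => 1
  | 1 => X - C c
  | n + 2 => (X - C c) * jPoly c α (n + 1) - C (α n) * jPoly c α n

theorem jPoly_coeff (c : R) (α : ℕ → R) (n : ℕ) :
    (jPoly c α n).coeff n = 1 ∧ ∀ k, n < k → (jPoly c α n).coeff k = 0 := by
  induction n using Nat.strong_induction_on with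
  | _ n ih =>
    match n with
    | 0 =>
      refine ⟨by simp [jPoly], fun k hk => ?_⟩
      rw [jPoly, coeff_one, if_neg (by omega)]
    | 1 =>
      refine ⟨by simp [jPoly], fun k hk => ?_⟩
      rw [jPoly, coeff_sub, coeff_X, coeff_C, if_neg (by omega), if_neg (by omega), sub_zero]
    | n + 2 =>
      obtain ⟨h1, h1'⟩ := ih (n + 1) (by omega)
      obtain ⟨-, h0'⟩ := ih n (by omega)
      refine ⟨?_, fun k hk => ?_⟩
      · simp [jPoly, sub_mul, coeff_X_mul, h1, h1', h0']
      · obtain ⟨k, rfl⟩ : ∃ j, k = j + 1 := ⟨k - 1, by omega⟩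
        simp [jPoly, sub_mul, coeff_X_mul, h1' k (by omega), h1' (k + 1) (by omega),
          h0' (k + 1) (by omega)]

/-- A functional that kills every `jPoly` of positive degree makes them orthogonal. -/
theorem jPoly_orthogonal (c : R) (α : ℕ → R) (L : R[X] →ₗ[R] R)
    (hL : ∀ n, L (jPoly c α (n + 1)) = 0) (j : ℕ) :
    (∀ n, j < n → L (X ^ j * jPoly c α n) = 0) ∧
      L (X ^ j * jPoly c α j) = L 1 * ∏ i ∈ Finset.range j, α i := by
  have hLC : ∀ (a : R) (p : R[X]), L (C a * p) = a * L p := fun a p => by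
    rw [C_mul', map_smul, smul_eq_mul]
  induction j with
  | zero =>
    refine ⟨fun n hn => ?_, by simp [jPoly]⟩
    obtain ⟨n, rfl⟩ : ∃ m, n = m + 1 := ⟨n - 1, by omega⟩
    simp [hL]
  | succ j ih =>
    have key : ∀ n, L (X ^ (j + 1) * jPoly c α (n + 1))
        = L (X ^ j * jPoly c α (n + 2)) + c * L (X ^ j * jPoly c α (n + 1))
          + α n * L (X ^ j * jPoly c α n) := by
      intro n
      rw [← hLC, ← hLC, ← map_add, ← map_add, show jPoly c α (n + 2)
        = (X - C c) * jPoly c α (n + 1) - C (α n) * jPoly c α n from rfl]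
      congr 1
      ring
    refine ⟨fun n hn => ?_, ?_⟩
    · obtain ⟨n, rfl⟩ : ∃ m, n = m + 1 := ⟨n - 1, by omega⟩
      rw [key, ih.1 _ (by omega), ih.1 _ (by omega), ih.1 _ (by omega)]
      simp
    · rw [key, ih.1 _ (by omega), ih.1 _ (by omega), ih.2, Finset.prod_range_succ]
      ring

theorem hankel_eq_prod_of_jPoly (c : R) (α : ℕ → R) (L : R[X] →ₗ[R] R)
    (hL : ∀ n, L (jPoly c α (n + 1)) = 0) (n : ℕ) :
    hankel (fun k => L (X ^ k)) n
      = ∏ i ∈ Finset.range (n + 1), (L 1 * ∏ j ∈ Finset.range i, α j) := by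
  let A : Matrix (Fin (n + 1)) (Fin (n + 1)) R := .of fun i k => (jPoly c α i).coeff k
  let M : Matrix (Fin (n + 1)) (Fin (n + 1)) R := .of fun i j => L (X ^ (i.1 + j.1))
  have hA : A.det = 1 := by
    rw [Matrix.det_of_isLowerTriangular]
    · exact Finset.prod_eq_one fun i _ => (jPoly_coeff c α i).1
    · intro i j hij
      exact (jPoly_coeff c α i).2 j hij
  have hAM : ∀ i j, (A * M) i j = L (X ^ j.1 * jPoly c α i) := by
    intro i j
    have hP : jPoly c α i = ∑ k ∈ Finset.range (n + 1), C ((jPoly c α i).coeff k) * X ^ k := by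
      refine as_sum_range_C_mul_X_pow' _ (Nat.lt_succ_iff.2 ?_)
      exact natDegree_le_iff_coeff_eq_zero.2 fun k hk =>
        (jPoly_coeff c α i).2 k (lt_of_le_of_lt (Nat.lt_succ_iff.1 i.2) hk)
    rw [hP, Finset.mul_sum, map_sum, Matrix.mul_apply, ← Fin.sum_univ_eq_sum_range
      (fun k => L (X ^ j.1 * (C ((jPoly c α i).coeff k) * X ^ k)))]
    refine Finset.sum_congr rfl fun k _ => ?_
    rw [mul_left_comm, ← pow_add, C_mul', map_smul, smul_eq_mul, add_comm j.1 k.1]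
    rfl
  calc hankel (fun k => L (X ^ k)) n = (A * M).det := by
        rw [Matrix.det_mul, hA, one_mul]; rfl
    _ = ∏ i : Fin (n + 1), (A * M) i i := by
        refine Matrix.det_of_isUpperTriangular fun i j hij => ?_
        rw [hAM]
        exact (jPoly_orthogonal c α L hL j).1 i hij
    _ = _ := by
        rw [← Fin.prod_univ_eq_prod_range (fun i => L 1 * ∏ j ∈ Finset.range i, α j)]
        refine Finset.prod_congr rfl fun i _ => ?_
        rw [hAM, (jPoly_orthogonal c α L hL i).2]

end JFraction

section DualHahn

open Polynomial

/-- `∏ i < k, ((i + 1) ^ 2 - (X - c) ^ 2)`. -/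
noncomputable def hahnFactor (c : ℚ) (k : ℕ) : ℚ[X] :=
  ∏ i ∈ Finset.range k, (C (((i : ℚ) + 1) ^ 2) - (X - C c) ^ 2)

/-- `∏ i < k, (i ^ 2 - (X - c) ^ 2)`. -/
noncomputable def hahnEven (c : ℚ) (k : ℕ) : ℚ[X] :=
  ∏ i ∈ Finset.range k, (C ((i : ℚ) ^ 2) - (X - C c) ^ 2)

/-- `(X - c) ∏ i < k, ((i + 1) ^ 2 - (X - c) ^ 2)`. -/
noncomputable def hahnOdd (c : ℚ) (k : ℕ) : ℚ[X] :=
  (X - C c) * hahnFactor c k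

/-- `∏ i < k, ((i + 1 / 2) ^ 2 - (X - c - 1 / 2) ^ 2)`. -/
noncomputable def hahnHalf (c : ℚ) (k : ℕ) : ℚ[X] :=
  ∏ i ∈ Finset.range k, (C (((i : ℚ) + 1 / 2) ^ 2) - (X - C (c + 1 / 2)) ^ 2)

theorem hahnEven_succ (c : ℚ) (k : ℕ) :
    hahnEven c (k + 1) = -((X - C c) * hahnOdd c k) := by
  rw [hahnEven, Finset.prod_range_succ', hahnOdd, hahnFactor]
  simp
  ring

theorem hahnOdd_succ (c : ℚ) (k : ℕ) :
    hahnOdd c (k + 1) = (C (((k : ℚ) + 1) ^ 2) - (X - C c) ^ 2) * hahnOdd c k := by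
  rw [hahnOdd, hahnOdd, hahnFactor, hahnFactor, Finset.prod_range_succ]
  ring

theorem hahnHalf_succ_eval (c z : ℚ) (k : ℕ) :
    (hahnHalf c (k + 1)).eval z
      = (hahnFactor c k).eval z * ((z - c) * (k + 1 - (z - c))) := by
  induction k with
  | zero => simp [hahnHalf, hahnFactor]; ring
  | succ k ih =>
    rw [hahnHalf, Finset.prod_range_succ, eval_mul, ← hahnHalf, ih, hahnFactor, hahnFactor,
      Finset.prod_range_succ, eval_mul]
    simp only [eval_sub, eval_C, eval_pow, eval_X]
    push_cast
    ring

theorem hahnHalf_succ_eval_add_one (c z : ℚ) (k : ℕ) :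
    (hahnHalf c (k + 1)).eval (z + 1)
      = (hahnFactor c k).eval z * (-(z - c) * (k + 1 + (z - c))) := by
  induction k with
  | zero => simp [hahnHalf, hahnFactor]; ring
  | succ k ih =>
    rw [hahnHalf, Finset.prod_range_succ, eval_mul, ← hahnHalf, ih, hahnFactor, hahnFactor,
      Finset.prod_range_succ, eval_mul]
    simp only [eval_sub, eval_C, eval_pow, eval_X]
    push_cast
    ring

theorem hahnHalf_comp_add (c : ℚ) (k : ℕ) :
    (hahnHalf c k).comp (X + 1) + hahnHalf c k = C 2 * hahnEven c k := by
  refine Polynomial.funext fun z => ?_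
  cases k with
  | zero => simp [hahnHalf, hahnEven]; norm_num
  | succ k =>
    rw [hahnEven_succ, hahnOdd]
    simp only [eval_add, eval_comp, eval_X, eval_one, eval_mul, eval_neg, eval_sub, eval_C,
      hahnHalf_succ_eval_add_one]
    rw [hahnHalf_succ_eval]
    ring

theorem X_sub_mul_hahnHalf_comp_add (c : ℚ) (k : ℕ) :
    ((X - C (c + 1 / 2)) * hahnHalf c (k + 1)).comp (X + 1)
        + (X - C (c + 1 / 2)) * hahnHalf c (k + 1)
      = C 2 * hahnOdd c (k + 1) - C (2 * ((k : ℚ) + 1) ^ 2 + (k + 1)) * hahnOdd c k := by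
  refine Polynomial.funext fun z => ?_
  rw [hahnOdd_succ, hahnOdd]
  simp only [eval_add, eval_comp, eval_X, eval_one, eval_mul, eval_sub, eval_C, eval_pow,
    hahnHalf_succ_eval_add_one]
  rw [hahnHalf_succ_eval]
  ring

/-- The product `∏ k ≤ i < n, w i` with `w i = (i + 1 / 2) ^ 2 - d ^ 2`. -/
noncomputable def hahnWeight (d : ℚ) (k n : ℕ) : ℚ :=
  ∏ i ∈ Finset.Ico k n, (((i : ℚ) + 1 / 2) ^ 2 - d ^ 2)

theorem hahnWeight_self (d : ℚ) (n : ℕ) : hahnWeight d n n = 1 := by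
  simp [hahnWeight]

theorem hahnWeight_succ_right (d : ℚ) {k n : ℕ} (h : k ≤ n) :
    hahnWeight d k (n + 1) = hahnWeight d k n * (((n : ℚ) + 1 / 2) ^ 2 - d ^ 2) :=
  Finset.prod_Ico_succ_top h _

theorem hahnWeight_succ_left (d : ℚ) {k n : ℕ} (h : k < n) :
    hahnWeight d k n = (((k : ℚ) + 1 / 2) ^ 2 - d ^ 2) * hahnWeight d (k + 1) n :=
  Finset.prod_eq_prod_Ico_succ_bot h _

theorem hahnWeight_zero_mul (d : ℚ) {k n : ℕ} (h : k ≤ n) :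
    hahnWeight d 0 k * hahnWeight d k n = hahnWeight d 0 n :=
  Finset.prod_Ico_consecutive _ (Nat.zero_le k) h

/-- Coefficients of the even-degree orthogonal polynomials in the basis `hahnEven`. -/
noncomputable def evenCoeff (d : ℚ) (n k : ℕ) : ℚ :=
  (-1) ^ k * n.choose k * hahnWeight d k n

/-- Coefficients of the odd-degree orthogonal polynomials in the basis `hahnOdd`. -/
noncomputable def oddCoeff (d : ℚ) (n k : ℕ) : ℚ :=
  (-1) ^ k * n.choose k * hahnWeight d (k + 1) (n + 1)

theorem evenCoeff_of_lt (d : ℚ) {n k : ℕ} (h : n < k) : evenCoeff d n k = 0 := by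
  simp [evenCoeff, Nat.choose_eq_zero_of_lt h]

theorem oddCoeff_of_lt (d : ℚ) {n k : ℕ} (h : n < k) : oddCoeff d n k = 0 := by
  simp [oddCoeff, Nat.choose_eq_zero_of_lt h]

theorem evenCoeff_succ_zero (d : ℚ) (n : ℕ) :
    evenCoeff d (n + 1) 0 = (((n : ℚ) + 1 / 2) ^ 2 - d ^ 2) * evenCoeff d n 0 := by
  simp [evenCoeff, hahnWeight_succ_right d (Nat.zero_le n), mul_comm]

theorem evenCoeff_succ_succ (d : ℚ) {n k : ℕ} (h : k ≤ n) :
    evenCoeff d (n + 1) (k + 1)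
      = -oddCoeff d n k + (((n : ℚ) + 1 / 2) ^ 2 - d ^ 2) * evenCoeff d n (k + 1) := by
  rcases h.eq_or_lt with rfl | h
  · rw [evenCoeff_of_lt d (Nat.lt_succ_self k)]
    simp [evenCoeff, oddCoeff, pow_succ]
  · rw [evenCoeff, evenCoeff, oddCoeff, hahnWeight_succ_right d h, Nat.choose_succ_succ]
    push_cast
    ring

theorem oddCoeff_succ (d : ℚ) {n k : ℕ} (h : k ≤ n + 1) :
    oddCoeff d (n + 1) k = evenCoeff d (n + 1) k
      - ((k : ℚ) + 1) ^ 2 * evenCoeff d (n + 1) (k + 1) + ((n : ℚ) + 1) ^ 2 * oddCoeff d n k := by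
  rcases h.eq_or_lt with rfl | h
  · rw [evenCoeff_of_lt d (Nat.lt_succ_self _), oddCoeff_of_lt d (Nat.lt_succ_self _)]
    simp [evenCoeff, oddCoeff, hahnWeight_self]
  · have hk : k ≤ n := Nat.lt_succ_iff.1 h
    have h1 : ((n : ℚ) + 1) * n.choose k = (n + 1).choose (k + 1) * (k + 1) := by
      exact_mod_cast Nat.add_one_mul_choose_eq n k
    have h2 : ((n + 1).choose (k + 1) : ℚ) * (k + 1) = (n + 1).choose k * (n + 1 - k) := by
      have := Nat.choose_succ_right_eq (n + 1) k
      rw [← Nat.cast_inj (R := ℚ)] at this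
      push_cast [Nat.cast_sub h.le] at this
      exact this
    simp only [evenCoeff, oddCoeff]
    rw [hahnWeight_succ_right d (show k + 1 ≤ n + 1 by omega), hahnWeight_succ_left d h]
    push_cast
    linear_combination (-1 : ℚ) ^ k * hahnWeight d (k + 1) (n + 1)
      * (-((n : ℚ) + 1) * h1 - (n + k + 2 : ℚ) * h2)

/-- The even-degree orthogonal polynomials. -/
noncomputable def hahnSumEven (c d : ℚ) (n : ℕ) : ℚ[X] :=
  ∑ k ∈ Finset.range (n + 1), C (evenCoeff d n k) * hahnEven c k

/-- The odd-degree orthogonal polynomials. -/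
noncomputable def hahnSumOdd (c d : ℚ) (n : ℕ) : ℚ[X] :=
  ∑ k ∈ Finset.range (n + 1), C (oddCoeff d n k) * hahnOdd c k

theorem hahnSumEven_succ (c d : ℚ) (n : ℕ) :
    hahnSumEven c d (n + 1) = (X - C c) * hahnSumOdd c d n
      + C (((n : ℚ) + 1 / 2) ^ 2 - d ^ 2) * hahnSumEven c d n := by
  have h : hahnSumEven c d n
      = ∑ k ∈ Finset.range (n + 2), C (evenCoeff d n k) * hahnEven c k := by
    rw [Finset.sum_range_succ, evenCoeff_of_lt d (Nat.lt_succ_self n), C_0, zero_mul, add_zero,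
      hahnSumEven]
  rw [h, hahnSumEven, hahnSumOdd,
    Finset.sum_range_succ' (fun k => C (evenCoeff d (n + 1) k) * hahnEven c k),
    Finset.sum_range_succ' (fun k => C (evenCoeff d n k) * hahnEven c k), mul_add,
    ← add_assoc, Finset.mul_sum, Finset.mul_sum, ← Finset.sum_add_distrib, evenCoeff_succ_zero,
    C_mul, mul_assoc]
  congr 1
  refine Finset.sum_congr rfl fun k hk => ?_
  rw [evenCoeff_succ_succ d (Nat.lt_succ_iff.1 (Finset.mem_range.1 hk)), hahnEven_succ, C_add,
    C_neg, C_mul]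
  ring

theorem X_sub_mul_hahnEven_succ (c : ℚ) (k : ℕ) :
    (X - C c) * hahnEven c (k + 1) = hahnOdd c (k + 1) - C (((k : ℚ) + 1) ^ 2) * hahnOdd c k := by
  rw [hahnEven_succ, hahnOdd_succ]
  ring

theorem hahnSumOdd_succ (c d : ℚ) (n : ℕ) :
    hahnSumOdd c d (n + 1) = (X - C c) * hahnSumEven c d (n + 1)
      + C (((n : ℚ) + 1) ^ 2) * hahnSumOdd c d n := by
  have h : hahnSumOdd c d n
      = ∑ k ∈ Finset.range (n + 2), C (oddCoeff d n k) * hahnOdd c k := by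
    rw [Finset.sum_range_succ, oddCoeff_of_lt d (Nat.lt_succ_self n), C_0, zero_mul, add_zero,
      hahnSumOdd]
  have hE : (X - C c) * hahnSumEven c d (n + 1)
      = ∑ k ∈ Finset.range (n + 2), C (evenCoeff d (n + 1) k
          - ((k : ℚ) + 1) ^ 2 * evenCoeff d (n + 1) (k + 1)) * hahnOdd c k := by
    have h0 : (X - C c) * hahnEven c 0 = hahnOdd c 0 := by
      simp [hahnEven, hahnOdd, hahnFactor]
    rw [Finset.sum_congr rfl fun k _ => by rw [C_sub, sub_mul], Finset.sum_sub_distrib,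
      hahnSumEven, Finset.mul_sum, Finset.sum_range_succ', mul_left_comm, h0,
      Finset.sum_range_succ' (fun k => C (evenCoeff d (n + 1) k) * hahnOdd c k),
      Finset.sum_range_succ _ (n + 1), evenCoeff_of_lt d (Nat.lt_succ_self (n + 1)),
      add_sub_right_comm, mul_zero, C_0, zero_mul, add_zero, ← Finset.sum_sub_distrib]
    congr 1
    refine Finset.sum_congr rfl fun k _ => ?_
    rw [mul_left_comm, X_sub_mul_hahnEven_succ, C_mul]
    ring
  rw [hE, h, hahnSumOdd, Finset.mul_sum, ← Finset.sum_add_distrib]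
  refine Finset.sum_congr rfl fun k hk => ?_
  rw [oddCoeff_succ d (Nat.lt_succ_iff.1 (Finset.mem_range.1 hk)), C_add, C_mul]
  ring

/-- The coefficients of the continued fraction of `E_{2k}(d + 1 / 2)`. -/
noncomputable def eulerFrac (d : ℚ) (n : ℕ) : ℚ :=
  if Even n then d ^ 2 - ((n + 1 : ℚ) / 2) ^ 2 else -((n + 1 : ℚ) / 2) ^ 2

theorem eulerFrac_even (d : ℚ) (n : ℕ) :
    eulerFrac d (2 * n) = -(((n : ℚ) + 1 / 2) ^ 2 - d ^ 2) := by
  rw [eulerFrac, if_pos (even_two_mul n)]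
  push_cast
  ring

theorem eulerFrac_odd (d : ℚ) (n : ℕ) :
    eulerFrac d (2 * n + 1) = -((n : ℚ) + 1) ^ 2 := by
  rw [eulerFrac, if_neg (by simp)]
  push_cast
  ring

theorem jPoly_eulerFrac (c d : ℚ) (n : ℕ) :
    jPoly c (eulerFrac d) (2 * n) = hahnSumEven c d n ∧
      jPoly c (eulerFrac d) (2 * n + 1) = hahnSumOdd c d n := by
  induction n with
  | zero =>
    simp [jPoly, hahnSumEven, hahnSumOdd, evenCoeff, oddCoeff, hahnWeight, hahnEven, hahnOdd,
      hahnFactor]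
  | succ n ih =>
    have h1 : jPoly c (eulerFrac d) (2 * (n + 1)) = hahnSumEven c d (n + 1) := by
      rw [show 2 * (n + 1) = 2 * n + 2 by ring, jPoly, ih.1, ih.2, eulerFrac_even, C_neg,
        hahnSumEven_succ]
      ring
    refine ⟨h1, ?_⟩
    rw [show 2 * (n + 1) + 1 = 2 * n + 1 + 2 by ring, jPoly,
      show 2 * n + 1 + 1 = 2 * (n + 1) by ring, h1, ih.2, eulerFrac_odd, C_neg, hahnSumOdd_succ]
    ring

variable {c d : ℚ} {L : ℚ[X] →ₗ[ℚ] ℚ}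

theorem apply_hahnEven
    (hL : ∀ p, L (p.comp (X + 1) + p) = 2 * (p.eval (c + 1 / 2 - d) + p.eval (c + 1 / 2 + d)))
    (k : ℕ) : L (hahnEven c k) = 2 * hahnWeight d 0 k := by
  have h := hL (hahnHalf c k)
  rw [hahnHalf_comp_add, C_mul', map_smul, smul_eq_mul] at h
  have hev : ∀ t : ℚ, t ^ 2 = d ^ 2 → (hahnHalf c k).eval (c + 1 / 2 + t) = hahnWeight d 0 k := by
    intro t ht
    simp only [hahnHalf, hahnWeight, eval_prod, eval_sub, eval_pow, eval_C, eval_X,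
      add_sub_cancel_left, ht, Finset.range_eq_Ico]
  rw [sub_eq_add_neg, hev _ (neg_sq d), hev d rfl] at h
  linarith

theorem apply_hahnOdd
    (hL : ∀ p, L (p.comp (X + 1) + p) = 2 * (p.eval (c + 1 / 2 - d) + p.eval (c + 1 / 2 + d)))
    (k : ℕ) : L (hahnOdd c k) = 0 := by
  induction k with
  | zero =>
    have h := hL (X - C (c + 1 / 2))
    have h0 : (X - C (c + 1 / 2)).comp (X + 1) + (X - C (c + 1 / 2)) = C 2 * hahnOdd c 0 := by
      refine Polynomial.funext fun z => ?_
      simp [hahnOdd, hahnFactor]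
      ring
    rw [h0, C_mul', map_smul, smul_eq_mul] at h
    simp only [eval_sub, eval_X, eval_C] at h
    linarith
  | succ k ih =>
    have h := hL ((X - C (c + 1 / 2)) * hahnHalf c (k + 1))
    rw [X_sub_mul_hahnHalf_comp_add, map_sub, C_mul', C_mul', map_smul, map_smul, ih, smul_zero,
      sub_zero, smul_eq_mul] at h
    have hev : (hahnHalf c (k + 1)).eval (c + 1 / 2 - d)
        = (hahnHalf c (k + 1)).eval (c + 1 / 2 + d) := by
      simp only [hahnHalf, eval_prod, eval_sub, eval_pow, eval_C, eval_X]
      exact Finset.prod_congr rfl fun i _ => by ring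
    simp only [eval_mul, eval_sub, eval_X, eval_C, hev] at h
    linarith

theorem apply_jPoly_eulerFrac
    (hL : ∀ p, L (p.comp (X + 1) + p) = 2 * (p.eval (c + 1 / 2 - d) + p.eval (c + 1 / 2 + d)))
    (n : ℕ) : L (jPoly c (eulerFrac d) (n + 1)) = 0 := by
  obtain ⟨m, hm⟩ := Nat.even_or_odd' (n + 1)
  rcases hm with hm | hm
  · rw [hm, (jPoly_eulerFrac c d m).1, hahnSumEven, map_sum]
    have hterm : ∀ k ∈ Finset.range (m + 1), L (C (evenCoeff d m k) * hahnEven c k)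
        = 2 * hahnWeight d 0 m * (((-1) ^ k * m.choose k : ℤ) : ℚ) := by
      intro k hk
      rw [C_mul', map_smul, smul_eq_mul, apply_hahnEven hL, evenCoeff,
        ← hahnWeight_zero_mul d (Nat.lt_succ_iff.1 (Finset.mem_range.1 hk))]
      push_cast
      ring
    rw [Finset.sum_congr rfl hterm, ← Finset.mul_sum, ← Int.cast_sum,
      Int.alternating_sum_range_choose_of_ne (by omega), Int.cast_zero, mul_zero]
  · rw [hm, (jPoly_eulerFrac c d m).2, hahnSumOdd, map_sum]
    refine Finset.sum_eq_zero fun k _ => ?_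
    rw [C_mul', map_smul, apply_hahnOdd hL, smul_zero]

end DualHahn

open Polynomial in
theorem hankel_eulerPoly_add (a b : ℚ) (n : ℕ) :
    hankel (fun k => eulerPoly k a + eulerPoly k b) n
      = ∏ i ∈ Finset.range (n + 1),
          (2 * ∏ j ∈ Finset.range i, eulerFrac ((b - a) / 2) j) := by
  let e : ℕ → ℚ := fun k => eulerPoly k a + eulerPoly k b
  let L : ℚ[X] →ₗ[ℚ] ℚ := (Polynomial.basisMonomials ℚ).constr ℚ e
  have hX : ∀ k, L (X ^ k) = e k := by
    intro k
    rw [← monomial_one_right_eq_X_pow]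
    simpa using (Polynomial.basisMonomials ℚ).constr_basis ℚ e k
  have hshift : ∀ y n, ∑ j ∈ Finset.range (n + 1), (n.choose j : ℚ) * eulerPoly j y
      = 2 * y ^ n - eulerPoly n y := by
    intro y n
    have := eulerPoly_eval_add n y 1
    simp only [one_pow, mul_one] at this
    linarith [eulerPoly_add_one_add n y]
  have hL : ∀ p, L (p.comp (X + 1) + p) = 2 * (p.eval a + p.eval b) := by
    intro p
    induction p using Polynomial.induction_on' with
    | add p q hp hq =>
      rw [add_comp, add_add_add_comm, map_add, hp, hq, eval_add, eval_add]
      ring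
    | monomial n r =>
      have h1 : L ((X + 1) ^ n) = 2 * (a ^ n + b ^ n) - e n := by
        rw [add_pow, map_sum]
        have : ∀ j ∈ Finset.range (n + 1), L (X ^ j * 1 ^ (n - j) * (n.choose j : ℚ[X]))
            = n.choose j * eulerPoly j a + n.choose j * eulerPoly j b := by
          intro j _
          rw [one_pow, mul_one, mul_comm, ← nsmul_eq_mul, map_nsmul, hX, nsmul_eq_mul, mul_add]
        rw [Finset.sum_congr rfl this, Finset.sum_add_distrib, hshift, hshift]
        ring
      rw [monomial_comp, ← C_mul_X_pow_eq_monomial, ← mul_add, C_mul', map_smul, map_add, h1, hX,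
        smul_eq_mul]
      simp only [eval_mul, eval_C, eval_pow, eval_X]
      ring
  have hone : L 1 = 2 := by
    have := hL 1
    simp only [one_comp, map_add, eval_one] at this
    linarith
  have hL' := apply_jPoly_eulerFrac (c := (a + b) / 2 - 1 / 2) (d := (b - a) / 2) (L := L)
    fun p => by rw [hL]; ring_nf
  have := hankel_eq_prod_of_jPoly _ _ L hL' n
  simpa only [hX, hone] using this

theorem prod_eulerFrac_odd (y : ℚ) (m : ℕ) :
    ∏ j ∈ Finset.range (2 * m + 1), eulerFrac (y / 2) j
      = (-1) ^ m * (m.factorial : ℚ) ^ 2 / 4 ^ (m + 1)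
        * ∏ ℓ ∈ Finset.range (m + 1), (y ^ 2 - (2 * (ℓ : ℚ) + 1) ^ 2) := by
  induction m with
  | zero =>
    simp [eulerFrac]
    ring
  | succ m ih =>
    rw [show 2 * (m + 1) + 1 = 2 * m + 1 + 1 + 1 by ring, Finset.prod_range_succ,
      Finset.prod_range_succ, ih, Finset.prod_range_succ _ (m + 1), eulerFrac_odd,
      show 2 * m + 1 + 1 = 2 * (m + 1) by ring, eulerFrac_even, Nat.factorial_succ]
    push_cast
    ring

theorem prod_Icc_hankel_succ (y : ℚ) (m : ℕ) :
    ∏ ℓ ∈ Finset.Icc 1 (m + 1),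
        (((ℓ : ℚ) ^ 2 / 4) * (y ^ 2 - (2 * (ℓ : ℚ) - 1) ^ 2)) ^ (2 * (m + 1 + 1 - ℓ))
      = (∏ ℓ ∈ Finset.Icc 1 m,
          (((ℓ : ℚ) ^ 2 / 4) * (y ^ 2 - (2 * (ℓ : ℚ) - 1) ^ 2)) ^ (2 * (m + 1 - ℓ)))
        * (((m + 1).factorial : ℚ) ^ 2 / 4 ^ (m + 1)
          * ∏ ℓ ∈ Finset.range (m + 1), (y ^ 2 - (2 * (ℓ : ℚ) + 1) ^ 2)) ^ 2 := by
  set f : ℕ → ℚ := fun ℓ => ((ℓ : ℚ) ^ 2 / 4) * (y ^ 2 - (2 * (ℓ : ℚ) - 1) ^ 2) with hf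
  have hfac : ∀ m : ℕ, ((m.factorial : ℚ) ^ 2 / 4 ^ m)
      * ∏ ℓ ∈ Finset.range m, (y ^ 2 - (2 * (ℓ : ℚ) + 1) ^ 2) = ∏ ℓ ∈ Finset.Icc 1 m, f ℓ := by
    intro m
    induction m with
    | zero => simp
    | succ m ih =>
      rw [Finset.prod_Icc_succ_top (by omega), ← ih, Finset.prod_range_succ, Nat.factorial_succ,
        hf]
      push_cast
      ring
  have hext : ∏ ℓ ∈ Finset.Icc 1 m, f ℓ ^ (2 * (m + 1 - ℓ))
      = ∏ ℓ ∈ Finset.Icc 1 (m + 1), f ℓ ^ (2 * (m + 1 - ℓ)) := by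
    rw [Finset.prod_Icc_succ_top (by omega)]
    simp
  rw [hfac, hext, ← Finset.prod_pow, ← Finset.prod_mul_distrib]
  refine Finset.prod_congr rfl fun ℓ hℓ => ?_
  rw [← pow_add]
  congr 1
  have := (Finset.mem_Icc.1 hℓ).2
  omega

theorem prod_range_hankel_succ (y : ℚ) (m : ℕ) :
    ∏ ℓ ∈ Finset.range (m + 1 + 1), ((ℓ.factorial : ℚ) ^ 4 / 16 ^ ℓ)
        * (y ^ 2 - (2 * (ℓ : ℚ) + 1) ^ 2) ^ (2 * (m + 1 - ℓ) + 1)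
      = (∏ ℓ ∈ Finset.range (m + 1), ((ℓ.factorial : ℚ) ^ 4 / 16 ^ ℓ)
          * (y ^ 2 - (2 * (ℓ : ℚ) + 1) ^ 2) ^ (2 * (m - ℓ) + 1))
        * (((m + 1).factorial : ℚ) ^ 4 / 16 ^ (m + 1)
          * (∏ ℓ ∈ Finset.range (m + 1), (y ^ 2 - (2 * (ℓ : ℚ) + 1) ^ 2)) ^ 2
          * (y ^ 2 - (2 * ((m + 1 : ℕ) : ℚ) + 1) ^ 2)) := by
  have h : ∏ ℓ ∈ Finset.range (m + 1), ((ℓ.factorial : ℚ) ^ 4 / 16 ^ ℓ)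
        * (y ^ 2 - (2 * (ℓ : ℚ) + 1) ^ 2) ^ (2 * (m + 1 - ℓ) + 1)
      = (∏ ℓ ∈ Finset.range (m + 1), ((ℓ.factorial : ℚ) ^ 4 / 16 ^ ℓ)
          * (y ^ 2 - (2 * (ℓ : ℚ) + 1) ^ 2) ^ (2 * (m - ℓ) + 1))
        * (∏ ℓ ∈ Finset.range (m + 1), (y ^ 2 - (2 * (ℓ : ℚ) + 1) ^ 2)) ^ 2 := by
    rw [← Finset.prod_pow, ← Finset.prod_mul_distrib]
    refine Finset.prod_congr rfl fun ℓ hℓ => ?_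
    rw [mul_assoc, ← pow_add]
    congr 2
    have := Finset.mem_range.1 hℓ
    omega
  rw [Finset.prod_range_succ, h, Nat.sub_self, mul_zero, zero_add, pow_one]
  ring

theorem hankel_euler_sum (q r s : ℕ) (hq : 1 ≤ q) (hrs : r < s) (x : ℚ) (m : ℕ) :
    hankel (fun k => eulerPoly k ((x + r) / q) + eulerPoly k ((x + s) / q)) (2 * m)
      = (-1 : ℚ) ^ m * (2 ^ (2 * m + 1) / (Nat.factorial m : ℚ) ^ 2) *
        ∏ ℓ ∈ Finset.Icc 1 m,
          (((ℓ : ℚ) ^ 2 / 4) * ((((s : ℚ) - r) / q) ^ 2 - (2 * (ℓ : ℚ) - 1) ^ 2))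
            ^ (2 * (m + 1 - ℓ)) ∧
    hankel (fun k => eulerPoly k ((x + r) / q) + eulerPoly k ((x + s) / q)) (2 * m + 1)
      = ∏ ℓ ∈ Finset.range (m + 1),
          ((Nat.factorial ℓ : ℚ) ^ 4 / 16 ^ ℓ) *
            ((((s : ℚ) - r) / q) ^ 2 - (2 * (ℓ : ℚ) + 1) ^ 2) ^ (2 * (m - ℓ) + 1) := by
  rw [hankel_eulerPoly_add, hankel_eulerPoly_add,
    show (x + s) / q - (x + r) / q = ((s : ℚ) - r) / q by ring]
  set y : ℚ := ((s : ℚ) - r) / q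
  induction m with
  | zero =>
    simp [Finset.prod_range_succ, eulerFrac]
    ring
  | succ m ih =>
    obtain ⟨ihe, iho⟩ := ih
    have hodd := prod_eulerFrac_odd y m
    have heven : ∏ j ∈ Finset.range (2 * m + 2), eulerFrac (y / 2) j
        = -((m : ℚ) + 1) ^ 2 * ∏ j ∈ Finset.range (2 * m + 1), eulerFrac (y / 2) j := by
      rw [Finset.prod_range_succ, eulerFrac_odd, mul_comm]
    have hodd' : ∏ j ∈ Finset.range (2 * m + 3), eulerFrac (y / 2) j
        = (y ^ 2 - (2 * ((m + 1 : ℕ) : ℚ) + 1) ^ 2) / 4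
          * ∏ j ∈ Finset.range (2 * m + 2), eulerFrac (y / 2) j := by
      rw [Finset.prod_range_succ, show 2 * m + 2 = 2 * (m + 1) by ring, eulerFrac_even]
      push_cast
      ring
    rw [hodd] at heven
    rw [heven] at hodd'
    have hm : (m : ℚ) + 1 ≠ 0 := by positivity
    have hf : (m.factorial : ℚ) ≠ 0 := by positivity
    have hsign : ((-1 : ℚ) ^ m) ^ 2 = 1 := by rw [← pow_mul, mul_comm, pow_mul]; simp
    have hpow : (16 : ℚ) ^ (m + 1) = (4 ^ (m + 1)) ^ 2 := by
      rw [← pow_mul, mul_comm, pow_mul]; norm_num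
    constructor
    · rw [show 2 * (m + 1) + 1 = 2 * m + 1 + 1 + 1 by ring, Finset.prod_range_succ,
        Finset.prod_range_succ, ihe, heven, hodd, prod_Icc_hankel_succ, Nat.factorial_succ,
        pow_succ (2 : ℚ) (2 * m + 2), pow_succ (2 : ℚ) (2 * m + 1), pow_succ (-1 : ℚ) m]
      generalize (-1 : ℚ) ^ m = u at *
      generalize (4 : ℚ) ^ (m + 1) = v at *
      generalize ∏ ℓ ∈ Finset.range (m + 1), (y ^ 2 - (2 * (ℓ : ℚ) + 1) ^ 2) = P at *
      generalize ∏ ℓ ∈ Finset.Icc 1 m, (_ : ℚ) = Q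
      push_cast
      field_simp
      linear_combination (-u * Q * P ^ 2 / v ^ 2) * hsign
    · rw [show 2 * (m + 1) + 1 + 1 = 2 * m + 1 + 1 + 1 + 1 by ring, Finset.prod_range_succ,
        Finset.prod_range_succ, iho, heven, prod_range_hankel_succ, hodd', hpow,
        Nat.factorial_succ]
      generalize (-1 : ℚ) ^ m = u at *
      generalize (4 : ℚ) ^ (m + 1) = v at *
      generalize ∏ ℓ ∈ Finset.range (m + 1), (y ^ 2 - (2 * (ℓ : ℚ) + 1) ^ 2) = P at *
      generalize y ^ 2 - (2 * ((m + 1 : ℕ) : ℚ) + 1) ^ 2 = w at *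
      push_cast
      generalize ∏ ℓ ∈ Finset.range (m + 1), (_ : ℚ) = Q
      linear_combination (Q * ((m : ℚ) + 1) ^ 4 * (m.factorial : ℚ) ^ 4 / v ^ 2 * P ^ 2 * w) * hsign
end

section
/- For an integer s ≥ 1 let T_k(s) = 1 − 2^k + 3^k − ... + (−1)^{s−1} s^k. If s = 2t is even, then for all m ≥ 0, H_{2m}(T_k(2t)) = 0 and H_{2m+1}(T_k(2t)) = (−t^2)^{m+1} · Π_{ℓ=1}^{m} ( ℓ^2(t^2 − ℓ^2) )^{2(m+1−ℓ)}; in particular H_{2m+1}(T_k(2t)) = 0 for m ≥ t. -/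
/-- The alternating power sum `T_k(s) = 1 - 2^k + 3^k - ⋯ + (-1)^{s-1} s^k`. -/
noncomputable def altPowerSum (s k : ℕ) : ℚ :=
  ∑ j ∈ Finset.Icc 1 s, (-1 : ℚ) ^ (j - 1) * (j : ℚ) ^ k

open Polynomial Matrix

/-- Hankel determinants of the moments of a linear functional can be computed in any pair of
bases of monic polynomials. -/
theorem det_monic_gram_eq_hankel {R : Type*} [CommRing R] (L : R[X] →ₗ[R] R)
    (p q : ℕ → R[X]) (hp : ∀ i, (p i).natDegree = i) (hpm : ∀ i, (p i).Monic)
    (hq : ∀ i, (q i).natDegree = i) (hqm : ∀ i, (q i).Monic) (n : ℕ) :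
    (Matrix.of fun i j : Fin (n + 1) => L (p i * q j)).det = hankel (fun k => L (X ^ k)) n := by
  have hU := det_matrixOfPolynomials (fun i : Fin (n + 1) => p i) (fun i => hp i) (fun i => hpm i)
  have hV := det_matrixOfPolynomials (fun i : Fin (n + 1) => q i) (fun i => hq i) (fun i => hqm i)
  have expansion : ∀ r : ℕ → R[X], (∀ i, (r i).natDegree = i) → ∀ i : Fin (n + 1),
      r i = ∑ k : Fin (n + 1), C ((r i).coeff k) * X ^ (k : ℕ) := by
    intro r hr i
    rw [Fin.sum_univ_eq_sum_range (fun k => C ((r i).coeff k) * X ^ k) (n + 1)]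
    exact (r i).as_sum_range_C_mul_X_pow' (by rw [hr]; exact i.2)
  have key : (Matrix.of fun i j : Fin (n + 1) => L (p i * q j))
      = (Matrix.of fun i j : Fin (n + 1) => (p j).coeff i)ᵀ
        * (Matrix.of fun i j : Fin (n + 1) => L (X ^ (i.1 + j.1)))
        * (Matrix.of fun i j : Fin (n + 1) => (q j).coeff i) := by
    ext i j
    simp only [Matrix.mul_apply, Matrix.of_apply, Matrix.transpose_apply]
    conv_lhs => rw [expansion p hp i, expansion q hq j]
    rw [Finset.sum_mul_sum, Finset.sum_comm, map_sum]
    refine Finset.sum_congr rfl fun l _ => ?_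
    rw [map_sum, Finset.sum_mul]
    refine Finset.sum_congr rfl fun k _ => ?_
    rw [show C ((p i).coeff k) * X ^ (k : ℕ) * (C ((q j).coeff l) * X ^ (l : ℕ))
        = ((p i).coeff k * (q j).coeff l) • (X : R[X]) ^ (k.1 + l.1) by
      rw [smul_eq_C_mul, C_mul]; ring, map_smul, smul_eq_mul]
    ring
  rw [key, det_mul, det_mul, det_transpose, hU, hV, one_mul, mul_one, hankel]

/-- The alternating sum of the values of a polynomial at the `2 t` half-integers
centred at the origin. -/
noncomputable def altSum (t : ℕ) : ℚ[X] →ₗ[ℚ] ℚ :=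
  ∑ j ∈ Finset.range (2 * t), (-1 : ℚ) ^ j • leval ((j : ℚ) + 1 / 2 - t)

theorem altSum_apply (t : ℕ) (p : ℚ[X]) :
    altSum t p = ∑ j ∈ Finset.range (2 * t), (-1 : ℚ) ^ j * p.eval ((j : ℚ) + 1 / 2 - t) := by
  simp [altSum]

theorem hankel_altPowerSum_eq_hankel_altSum (t n : ℕ) :
    hankel (altPowerSum (2 * t)) n = hankel (fun k => altSum t (X ^ k)) n := by
  have hd : ∀ i, ((X + C ((t : ℚ) + 1 / 2)) ^ i).natDegree = i := fun i => by
    rw [natDegree_pow, natDegree_X_add_C, mul_one]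
  have hm : ∀ i, ((X + C ((t : ℚ) + 1 / 2)) ^ i).Monic := fun i => (monic_X_add_C _).pow i
  rw [← det_monic_gram_eq_hankel (altSum t) _ _ hd hm hd hm, hankel]
  congr 1
  ext i j
  rw [of_apply, of_apply, ← pow_add, altSum_apply, altPowerSum, ← Finset.Ico_add_one_right_eq_Icc,
    Finset.sum_Ico_eq_sum_range]
  refine Finset.sum_congr rfl fun k _ => ?_
  rw [Nat.add_sub_cancel_left]
  simp only [eval_pow, eval_add, eval_X, eval_C]
  push_cast
  ring

theorem altSum_eq_zero_of_even (t : ℕ) (p : ℚ[X]) (hp : ∀ x, p.eval (-x) = p.eval x) :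
    altSum t p = 0 := by
  have h : altSum t p = -altSum t p := by
    conv_lhs => rw [altSum_apply, ← Finset.sum_range_reflect]
    rw [altSum_apply, ← Finset.sum_neg_distrib]
    refine Finset.sum_congr rfl fun j hj => ?_
    have hj' := Finset.mem_range.1 hj
    obtain ⟨i, hi⟩ : ∃ i, 2 * t = j + 1 + i := ⟨2 * t - j - 1, by omega⟩
    have ht : (2 * t : ℚ) = j + 1 + i := by exact_mod_cast hi
    have hs : 2 * t - 1 - j = i := by omega
    have hsign : (-1 : ℚ) ^ i = -(-1) ^ j := by
      have h1 : (-1 : ℚ) ^ (j + 1 + i) = 1 := by rw [← hi]; simp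
      have h2 : (-1 : ℚ) ^ j * (-1) ^ j = 1 := by rw [← mul_pow]; simp
      rw [pow_add, pow_succ] at h1
      linear_combination (-(-1 : ℚ) ^ j) * h1 - (-1 : ℚ) ^ i * h2
    rw [hs, hsign, ← hp, neg_mul]
    congr 3
    linear_combination ht
  linarith

theorem hankel_eq_zero_of_even_moments {c : ℕ → ℚ} (hc : ∀ k, c (2 * k) = 0) (m : ℕ) :
    hankel c (2 * m) = 0 := by
  have h : (Matrix.of fun i j : Fin (2 * m + 1) => c (i.1 + j.1))
      = -(diagonal (fun i : Fin (2 * m + 1) => (-1 : ℚ) ^ i.1)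
        * (Matrix.of fun i j : Fin (2 * m + 1) => c (i.1 + j.1))
        * diagonal (fun i : Fin (2 * m + 1) => (-1 : ℚ) ^ i.1)) := by
    ext i j
    rw [Matrix.neg_apply, mul_diagonal, diagonal_mul, of_apply]
    rcases Nat.even_or_odd' (i.1 + j.1) with ⟨k, hk | hk⟩
    · rw [hk, hc]; simp
    · have : (-1 : ℚ) ^ i.1 * (-1) ^ j.1 = -1 := by rw [← pow_add, hk, pow_succ, pow_mul]; simp
      linear_combination c (i.1 + j.1) * this
  have hD : (∏ i : Fin (2 * m + 1), (-1 : ℚ) ^ i.1) * ∏ i : Fin (2 * m + 1), (-1 : ℚ) ^ i.1 = 1 := by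
    rw [← Finset.prod_mul_distrib]
    exact Finset.prod_eq_one fun i _ => by rw [← mul_pow]; simp
  have h2 := congrArg Matrix.det h
  rw [det_neg, det_mul, det_mul, det_diagonal, Fintype.card_fin, pow_succ, pow_mul, neg_one_sq,
    one_pow] at h2
  rw [hankel]
  linear_combination (1 / 2 : ℚ) * h2
    - (1 / 2 : ℚ) * (Matrix.of fun i j : Fin (2 * m + 1) => c (i.1 + j.1)).det * hD

/-- If the even moments vanish, an even-sized Hankel determinant reduces to a Gram determinant
of half the size. -/
theorem hankel_odd_eq_gram {L : ℚ[X] →ₗ[ℚ] ℚ}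
    (hL : ∀ p : ℚ[X], (∀ x, p.eval (-x) = p.eval x) → L p = 0)
    (p q : ℕ → ℚ[X]) (hp : ∀ i, (p i).natDegree = i) (hpm : ∀ i, (p i).Monic)
    (hq : ∀ i, (q i).natDegree = i) (hqm : ∀ i, (q i).Monic) (m : ℕ) :
    hankel (fun k => L (X ^ k)) (2 * m + 1)
      = (-1) ^ (m + 1)
        * (Matrix.of fun i j : Fin (m + 1) => L (expand ℚ 2 (p i * q j) * X)).det ^ 2 := by
  have hd : ∀ r : ℕ → ℚ[X], (∀ i, (r i).natDegree = i) → (∀ i, (r i).Monic) →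
      ∀ i, (expand ℚ 2 (r (i / 2)) * X ^ (i % 2)).natDegree = i := by
    intro r hr hrm i
    rw [((hrm _).expand two_pos).natDegree_mul (monic_X_pow _), natDegree_expand, hr,
      natDegree_X_pow]
    omega
  have hm : ∀ r : ℕ → ℚ[X], (∀ i, (r i).Monic) →
      ∀ i, (expand ℚ 2 (r (i / 2)) * X ^ (i % 2)).Monic := fun r hrm i =>
    ((hrm _).expand two_pos).mul (monic_X_pow _)
  rw [← det_monic_gram_eq_hankel L _ _ (hd p hp hpm) (hm p hpm) (hd q hq hqm) (hm q hqm)]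
  let e : Fin (m + 1) × Fin 2 ≃ Fin (2 * m + 1 + 1) :=
    finProdFinEquiv.trans (finCongr (by ring))
  have he : ∀ i a, ((e (i, a) : Fin (2 * m + 1 + 1)) : ℕ) = a + 2 * i := fun i a => rfl
  rw [← det_submatrix_equiv_self e]
  have key : (Matrix.of fun i j : Fin (2 * m + 1 + 1) =>
        L (expand ℚ 2 (p (i / 2)) * X ^ (i.1 % 2) * (expand ℚ 2 (q (j / 2)) * X ^ (j.1 % 2)))).submatrix
          e e
      = kroneckerMap (· * ·)
        (Matrix.of fun i j : Fin (m + 1) => L (expand ℚ 2 (p i * q j) * X)) !![0, 1; 1, 0] := by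
    ext ⟨i, a⟩ ⟨j, b⟩
    rw [submatrix_apply, kroneckerMap_apply, of_apply, of_apply, he, he,
      show (a.1 + 2 * i.1) / 2 = i by omega, show (b.1 + 2 * j.1) / 2 = j by omega,
      show (a.1 + 2 * i.1) % 2 = a by omega, show (b.1 + 2 * j.1) % 2 = b by omega,
      show expand ℚ 2 (p i) * X ^ a.1 * (expand ℚ 2 (q j) * X ^ b.1)
        = expand ℚ 2 (p i * q j) * X ^ (a.1 + b.1) by rw [map_mul]; ring]
    have hz : ∀ k, L (expand ℚ 2 (p i * q j) * X ^ (2 * k)) = 0 := fun k => hL _ fun x => by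
      simp [expand_eval, pow_mul]
    fin_cases a <;> fin_cases b
    · simpa using hz 0
    · simp
    · simp
    · simpa using hz 1
  rw [key, det_kronecker, det_fin_two_of]
  simp [mul_comm]

/-- The central factorial polynomials with half-integer roots, in the squared variable. -/
noncomputable def centralFactorial (n : ℕ) : ℚ[X] :=
  ∏ k ∈ Finset.range n, (X - C (((k : ℚ) + 1 / 2) ^ 2))

theorem monic_centralFactorial (n : ℕ) : (centralFactorial n).Monic :=
  monic_prod_of_monic _ _ fun _ _ => monic_X_sub_C _

theorem natDegree_centralFactorial (n : ℕ) : (centralFactorial n).natDegree = n := by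
  rw [centralFactorial, natDegree_prod_of_monic _ _ fun _ _ => monic_X_sub_C _]
  simp only [natDegree_X_sub_C, Finset.sum_const, Finset.card_range, smul_eq_mul, mul_one]

/-- The monic polynomials orthogonal for the functional `p ↦ altSum t (p(X ^ 2) * X)`. -/
noncomputable def orthoPoly (t : ℚ) : ℕ → ℚ[X]
  | 0 => 1
  | 1 => X - C (t ^ 2 - 3 / 4)
  | k + 2 => (X - C (t ^ 2 - 3 / 4 - 2 * (k + 1) - 2 * (k + 1) ^ 2)) * orthoPoly t (k + 1)
      + C ((k + 1) ^ 2 * (t ^ 2 - (k + 1) ^ 2)) * orthoPoly t k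

theorem orthoPoly_monic_natDegree (t : ℚ) (n : ℕ) :
    (orthoPoly t n).Monic ∧ (orthoPoly t n).natDegree = n := by
  induction n using Nat.twoStepInduction with
  | zero => simp [orthoPoly]
  | one => rw [orthoPoly]; exact ⟨monic_X_sub_C _, natDegree_X_sub_C _⟩
  | more k h0 h1 =>
    rw [orthoPoly]
    set a := t ^ 2 - 3 / 4 - 2 * ((k : ℚ) + 1) - 2 * ((k : ℚ) + 1) ^ 2
    have hM : ((X - C a) * orthoPoly t (k + 1)).Monic := (monic_X_sub_C a).mul h1.1
    have hD : ((X - C a) * orthoPoly t (k + 1)).natDegree = k + 2 := by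
      rw [(monic_X_sub_C a).natDegree_mul h1.1, natDegree_X_sub_C, h1.2]; ring
    have hlt : (C (((k : ℚ) + 1) ^ 2 * (t ^ 2 - ((k : ℚ) + 1) ^ 2)) * orthoPoly t k).natDegree
        < ((X - C a) * orthoPoly t (k + 1)).natDegree := by
      rw [hD]
      exact (natDegree_C_mul_le _ _).trans_lt (by omega)
    exact ⟨hM.add_of_left (degree_lt_degree hlt), by
      rw [natDegree_add_eq_left_of_natDegree_lt hlt, hD]⟩

theorem eval_centralFactorial_mul (n : ℕ) (z : ℚ) :
    (z + n) * (centralFactorial n).eval ((z - 1 / 2) ^ 2)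
      = z * ∏ l ∈ Finset.range n, (z ^ 2 - ((l : ℚ) + 1) ^ 2) := by
  induction n with
  | zero => simp [centralFactorial]
  | succ n ih =>
    rw [Finset.prod_range_succ, ← mul_assoc, ← ih, centralFactorial, Finset.prod_range_succ,
      ← centralFactorial]
    simp only [eval_mul, eval_sub, eval_X, eval_C]
    push_cast
    ring

theorem altSum_expand_centralFactorial (t n : ℕ) :
    altSum t (expand ℚ 2 (centralFactorial n) * X)
      = -(t * ∏ l ∈ Finset.range n, ((t : ℚ) ^ 2 - ((l : ℚ) + 1) ^ 2)) := by
  set g : ℚ → ℚ := fun z => z * ∏ l ∈ Finset.range n, (z ^ 2 - ((l : ℚ) + 1) ^ 2) with hg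
  have g_neg : ∀ z, g (-z) = -g z := fun z => by simp [hg]
  have step : ∀ z : ℚ, (centralFactorial n).eval ((z + 1 / 2) ^ 2) * (z + 1 / 2)
      = (g (z + 1) + g z) / 2 := fun z => by
    have h1 := eval_centralFactorial_mul n (z + 1)
    have h2 := eval_centralFactorial_mul n (-z)
    have h3 : -z * ∏ l ∈ Finset.range n, ((-z) ^ 2 - ((l : ℚ) + 1) ^ 2) = -g z := g_neg z
    rw [h3, show (-z - 1 / 2) ^ 2 = (z + 1 / 2) ^ 2 by ring] at h2
    rw [show z + 1 - 1 / 2 = z + 1 / 2 by ring] at h1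
    change _ = g (z + 1) at h1
    linear_combination (1 / 2 : ℚ) * h1 - (1 / 2 : ℚ) * h2
  have tele : ∀ s : ℕ, ∑ j ∈ Finset.range s, (-1 : ℚ) ^ j
      * (expand ℚ 2 (centralFactorial n) * X).eval ((j : ℚ) + 1 / 2 - t)
      = (g (-t) - (-1) ^ s * g (s - t)) / 2 := by
    intro s
    induction s with
    | zero => simp
    | succ s ih =>
      rw [Finset.sum_range_succ, ih, eval_mul, eval_X, expand_eval,
        show (s : ℚ) + 1 / 2 - t = (s - t) + 1 / 2 by ring, step]
      push_cast
      rw [show (s : ℚ) - t + 1 = s + 1 - t by ring]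
      ring
  rw [altSum_apply, tele, g_neg, pow_mul]
  push_cast
  rw [show (2 * t - t : ℚ) = t by ring]
  change _ = -g t
  norm_num
  ring

theorem altSum_centralFactorial_mul_orthoPoly (t k n : ℕ) :
    altSum t (expand ℚ 2 (centralFactorial n * orthoPoly t k) * X)
      = (-1) ^ k * k.factorial * (∏ i ∈ Finset.range k, ((n : ℚ) - i))
        * -(t * ∏ l ∈ Finset.range n, ((t : ℚ) ^ 2 - ((l : ℚ) + 1) ^ 2)) := by
  have shift : ∀ (n : ℕ) (p : ℚ[X]) (a : ℚ),
      altSum t (expand ℚ 2 (centralFactorial n * ((X - C a) * p)) * X)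
        = altSum t (expand ℚ 2 (centralFactorial (n + 1) * p) * X)
          + (((n : ℚ) + 1 / 2) ^ 2 - a)
            * altSum t (expand ℚ 2 (centralFactorial n * p) * X) := by
    intro n p a
    rw [← smul_eq_mul (_ - a), ← map_smul, ← map_add]
    congr 1
    rw [smul_eq_C_mul, centralFactorial, centralFactorial, Finset.prod_range_succ]
    simp only [map_mul, map_sub, expand_X, expand_C]
    ring
  have falling : ∀ (n k : ℕ), ∏ i ∈ Finset.range (k + 1), (((n + 1 : ℕ) : ℚ) - i)
      = (n + 1) * ∏ i ∈ Finset.range k, ((n : ℚ) - i) := by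
    intro n k
    rw [Finset.prod_range_succ', mul_comm]
    push_cast
    simp only [sub_zero, add_sub_add_right_eq_sub]
  induction k using Nat.twoStepInduction generalizing n with
  | zero => simp [orthoPoly, altSum_expand_centralFactorial]
  | one =>
    have h := shift n 1 ((t : ℚ) ^ 2 - 3 / 4)
    rw [mul_one, mul_one, mul_one, altSum_expand_centralFactorial,
      altSum_expand_centralFactorial, Finset.prod_range_succ] at h
    rw [orthoPoly, h]
    simp
    ring
  | more k h0 h1 =>
    have lin : ∀ b : ℚ, altSum t (expand ℚ 2 (centralFactorial n * (C b * orthoPoly t k)) * X)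
        = b * altSum t (expand ℚ 2 (centralFactorial n * orthoPoly t k) * X) := by
      intro b
      rw [← smul_eq_mul b, ← map_smul, smul_eq_C_mul]
      congr 1
      simp only [map_mul, expand_C]
      ring
    rw [orthoPoly, mul_add, map_add, add_mul, map_add, shift, lin, h0, h1, h1, falling,
      Finset.prod_range_succ _ (k + 1), Finset.prod_range_succ _ k, Finset.prod_range_succ _ n,
      Nat.factorial_succ (k + 1), Nat.factorial_succ k]
    push_cast
    ring

theorem prod_range_prod_eq_prod_pow {M : Type*} [CommMonoid M] (f : ℕ → M) (m : ℕ) :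
    ∏ k ∈ Finset.range (m + 1), ∏ l ∈ Finset.range k, f (l + 1)
      = ∏ l ∈ Finset.Icc 1 m, f l ^ (m + 1 - l) := by
  induction m with
  | zero => simp
  | succ m ih =>
    rw [Finset.prod_range_succ, ih, Finset.prod_range_succ, ← mul_assoc,
      Finset.prod_Icc_succ_top (by omega), Nat.add_sub_cancel_left, pow_one]
    congr 1
    rw [Finset.range_eq_Ico, Finset.prod_Ico_add' f 0 m 1, zero_add,
      Finset.Ico_add_one_right_eq_Icc, ← Finset.prod_mul_distrib]
    refine Finset.prod_congr rfl fun l hl => ?_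
    have := (Finset.mem_Icc.1 hl).2
    rw [← pow_succ]
    congr 1
    omega

theorem det_gram_sq (t m : ℕ) :
    (Matrix.of fun i j : Fin (m + 1) =>
      altSum t (expand ℚ 2 (centralFactorial i * orthoPoly t j) * X)).det ^ 2
      = ((t : ℚ) ^ 2) ^ (m + 1) * ∏ ℓ ∈ Finset.Icc 1 m,
          ((ℓ : ℚ) ^ 2 * ((t : ℚ) ^ 2 - (ℓ : ℚ) ^ 2)) ^ (2 * (m + 1 - ℓ)) := by
  have fact : ∀ k : ℕ, ∏ i ∈ Finset.range k, ((k : ℚ) - i) = ∏ l ∈ Finset.range k, ((l : ℚ) + 1) := by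
    intro k
    rw [← Finset.prod_range_reflect]
    refine Finset.prod_congr rfl fun i hi => ?_
    have := Finset.mem_range.1 hi
    rw [Nat.sub_sub, Nat.cast_sub (by omega)]
    push_cast
    ring
  have fact' : ∀ k : ℕ, (k.factorial : ℚ) = ∏ l ∈ Finset.range k, ((l : ℚ) + 1) := by
    intro k
    rw [← Finset.prod_range_add_one_eq_factorial]
    push_cast
    rfl
  rw [det_of_isLowerTriangular]
  · simp only [of_apply, altSum_centralFactorial_mul_orthoPoly]
    rw [Fin.prod_univ_eq_prod_range (fun k : ℕ => (-1 : ℚ) ^ k * k.factorial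
      * (∏ i ∈ Finset.range k, ((k : ℚ) - i))
        * -(t * ∏ l ∈ Finset.range k, ((t : ℚ) ^ 2 - ((l : ℚ) + 1) ^ 2))) (m + 1),
      ← Finset.prod_pow]
    simp only [pow_mul]
    rw [← prod_range_prod_eq_prod_pow
        (fun ℓ => (((ℓ : ℚ) ^ 2 * ((t : ℚ) ^ 2 - (ℓ : ℚ) ^ 2)) ^ 2)) m,
      ← Finset.card_range (m + 1), ← Finset.prod_const, Finset.card_range,
      ← Finset.prod_mul_distrib]
    refine Finset.prod_congr rfl fun k _ => ?_
    have sign : ((-1 : ℚ) ^ k) ^ 2 = 1 := by rw [← pow_mul']; simp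
    rw [fact, fact', Finset.prod_pow, Finset.prod_mul_distrib, Finset.prod_pow]
    push_cast
    linear_combination (t ^ 2 * (∏ l ∈ Finset.range k, ((l : ℚ) + 1)) ^ 4
      * (∏ l ∈ Finset.range k, ((t : ℚ) ^ 2 - ((l : ℚ) + 1) ^ 2)) ^ 2) * sign
  · intro i j hij
    rw [of_apply, altSum_centralFactorial_mul_orthoPoly,
      Finset.prod_eq_zero (Finset.mem_range.2 (show i.1 < j.1 from hij)) (sub_self _)]
    ring

theorem hankel_altPowerSum_even (t : ℕ) (ht : 1 ≤ t) (m : ℕ) :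
    hankel (altPowerSum (2 * t)) (2 * m) = 0 ∧
    hankel (altPowerSum (2 * t)) (2 * m + 1)
      = (-(t : ℚ) ^ 2) ^ (m + 1) *
        ∏ ℓ ∈ Finset.Icc 1 m,
          ((ℓ : ℚ) ^ 2 * ((t : ℚ) ^ 2 - (ℓ : ℚ) ^ 2)) ^ (2 * (m + 1 - ℓ)) ∧
    (t ≤ m → hankel (altPowerSum (2 * t)) (2 * m + 1) = 0) := by
  have hz : ∀ k, altSum t (X ^ (2 * k)) = 0 := fun k =>
    altSum_eq_zero_of_even t _ fun x => by simp [pow_mul]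
  have hodd : hankel (altPowerSum (2 * t)) (2 * m + 1)
      = (-(t : ℚ) ^ 2) ^ (m + 1) *
        ∏ ℓ ∈ Finset.Icc 1 m,
          ((ℓ : ℚ) ^ 2 * ((t : ℚ) ^ 2 - (ℓ : ℚ) ^ 2)) ^ (2 * (m + 1 - ℓ)) := by
    rw [hankel_altPowerSum_eq_hankel_altSum,
      hankel_odd_eq_gram (altSum_eq_zero_of_even t) centralFactorial (orthoPoly t)
        natDegree_centralFactorial monic_centralFactorial
        (fun i => (orthoPoly_monic_natDegree t i).2) (fun i => (orthoPoly_monic_natDegree t i).1),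
      det_gram_sq, ← mul_assoc, ← mul_pow, neg_one_mul]
  refine ⟨?_, hodd, fun htm => ?_⟩
  · rw [hankel_altPowerSum_eq_hankel_altSum]
    exact hankel_eq_zero_of_even_moments hz m
  · rw [hodd, Finset.prod_eq_zero (Finset.mem_Icc.2 ⟨ht, htm⟩), mul_zero]
    rw [sub_self, mul_zero]
    exact zero_pow (by omega)
end

section
/- For all n ≥ 0, the Hankel determinant of the sequence ((2k+1)·E_{2k})_{k≥0} of scaled Euler numbers equals 2^{2n(n+1)} · Π_{ℓ=1}^{n} (ℓ!)^4, i.e., det_{0≤i,j≤n}((2(i+j)+1)E_{2(i+j)}) = 2^{2n(n+1)} Π_{ℓ=1}^{n} (ℓ!)^4. -/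
/-- The `n`-th Euler number `E_n = 2^n E_n(1/2)`. -/
noncomputable def eulerNum (n : ℕ) : ℚ := 2 ^ n * eulerPoly n (1 / 2)

open Polynomial

/-- The linear functional on `ℚ[X]` sending `X ^ n` to the `n`-th Bernoulli number. -/
noncomputable def bernoulliFunctional : ℚ[X] →ₗ[ℚ] ℚ :=
  Polynomial.lsum fun n => LinearMap.mulRight ℚ (_root_.bernoulli n)

theorem bernoulliFunctional_monomial (n : ℕ) (a : ℚ) :
    bernoulliFunctional (monomial n a) = a * _root_.bernoulli n := by
  simp [bernoulliFunctional, Polynomial.lsum_apply]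

theorem bernoulliFunctional_C_mul (a : ℚ) (p : ℚ[X]) :
    bernoulliFunctional (C a * p) = a * bernoulliFunctional p := by
  rw [C_mul', map_smul, smul_eq_mul]

theorem bernoulliFunctional_X_add_C_pow (n : ℕ) (x : ℚ) :
    bernoulliFunctional ((X + C x) ^ n) = (Polynomial.bernoulli n).eval x := by
  rw [add_pow, map_sum, Polynomial.bernoulli, eval_finsetSum]
  refine Finset.sum_congr rfl fun i _ => ?_
  have h : (X : ℚ[X]) ^ i * C x ^ (n - i) * (n.choose i : ℚ[X])
      = monomial i (x ^ (n - i) * n.choose i) := by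
    rw [← C_mul_X_pow_eq_monomial, C_mul, C_pow, C_eq_natCast]
    ring
  rw [h, bernoulliFunctional_monomial, eval_monomial]
  ring

theorem bernoulliFunctional_affine_pow (n : ℕ) {a : ℚ} (ha : a ≠ 0) (b : ℚ) :
    bernoulliFunctional ((C a * X + C b) ^ n) = a ^ n * (Polynomial.bernoulli n).eval (b / a) := by
  have h : (C a * X + C b : ℚ[X]) = C a * (X + C (b / a)) := by
    rw [mul_add, ← C_mul, mul_div_cancel₀ _ ha]
  rw [h, mul_pow, ← C_pow, bernoulliFunctional_C_mul, bernoulliFunctional_X_add_C_pow]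

theorem bernoulliFunctional_comp_X_add_one (p : ℚ[X]) :
    bernoulliFunctional (p.comp (X + 1)) = bernoulliFunctional p + p.derivative.eval 0 := by
  induction p using Polynomial.induction_on' with
  | add p q hp hq => simp only [add_comp, map_add, eval_add, hp, hq]; ring
  | monomial n a =>
    have h₁ := bernoulliFunctional_X_add_C_pow n 1
    have h₂ := Polynomial.bernoulli_eval_one_add n 0
    rw [add_zero, Polynomial.bernoulli_eval_zero] at h₂
    rw [monomial_comp, bernoulliFunctional_C_mul, ← C_1, h₁, h₂, bernoulliFunctional_monomial,
      derivative_monomial, eval_monomial]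
    ring

theorem bernoulliFunctional_duplication (p : ℚ[X]) :
    bernoulliFunctional (p.comp (C 2 * X)) + bernoulliFunctional (p.comp (C 2 * X + 1))
      = 2 * bernoulliFunctional p := by
  have diff (q : ℚ[X]) :
      bernoulliFunctional ((q.comp (X + 1)).comp (C 2 * X))
          + bernoulliFunctional ((q.comp (X + 1)).comp (C 2 * X + 1))
          - 2 * bernoulliFunctional (q.comp (X + 1))
        = bernoulliFunctional (q.comp (C 2 * X)) + bernoulliFunctional (q.comp (C 2 * X + 1))
          - 2 * bernoulliFunctional q := by
    have h₁ : (q.comp (X + 1)).comp (C 2 * X) = q.comp (C 2 * X + 1) := by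
      simp [comp_assoc]
    have h₂ : (q.comp (X + 1)).comp (C 2 * X + 1) = (q.comp (C 2 * X)).comp (X + 1) := by
      simp only [comp_assoc, add_comp, mul_comp, X_comp, C_comp, one_comp]
      congr 1
      rw [C_ofNat]
      ring
    rw [h₁, h₂, bernoulliFunctional_comp_X_add_one, bernoulliFunctional_comp_X_add_one q]
    simp [derivative_comp]
    ring
  induction p using Polynomial.induction_on' with
  | add p q hp hq => simp only [add_comp, map_add]; linarith
  | monomial n a =>
    have h := diff (Polynomial.bernoulli (n + 1))
    have hB : (Polynomial.bernoulli (n + 1)).comp (X + 1)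
        = Polynomial.bernoulli (n + 1) + (n + 1 : ℚ) • X ^ n := by
      rw [add_comm X, Polynomial.bernoulli_comp_one_add_X, smul_eq_C_mul]
      simp
    simp only [hB, add_comp, smul_comp, map_add, map_smul, smul_eq_mul] at h
    have hn : (n + 1 : ℚ) ≠ 0 := by positivity
    rw [← smul_X_eq_monomial]
    simp only [smul_comp, map_smul, smul_eq_mul]
    apply mul_left_cancel₀ hn
    linear_combination a * h

/-- The linear functional on `ℚ[X]` sending `X ^ (n + 1)` to `(n + 1) * eulerNum n`, that is,
differentiation followed by the functional with moments `eulerNum n`. -/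
noncomputable def eulerDerivFunctional : ℚ[X] →ₗ[ℚ] ℚ :=
  bernoulliFunctional ∘ₗ
    ((compRingHom (C 2 * X + C 1 : ℚ[X])).toAddMonoidHom.toRatLinearMap
      - (compRingHom (C 4 * X + C 1 : ℚ[X])).toAddMonoidHom.toRatLinearMap)

theorem eulerDerivFunctional_apply (p : ℚ[X]) :
    eulerDerivFunctional p = bernoulliFunctional (p.comp (C 2 * X + C 1))
      - bernoulliFunctional (p.comp (C 4 * X + C 1)) := by
  simp [eulerDerivFunctional]

theorem eulerDerivFunctional_X_pow_succ (n : ℕ) :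
    eulerDerivFunctional (X ^ (n + 1)) = (n + 1) * eulerNum n := by
  have hn : (n + 1 : ℚ) ≠ 0 := by positivity
  rw [eulerDerivFunctional_apply, X_pow_comp, X_pow_comp,
    bernoulliFunctional_affine_pow _ (by norm_num), bernoulliFunctional_affine_pow _ (by norm_num),
    eulerNum, eulerPoly, show (4 : ℚ) = 2 * 2 by norm_num, mul_pow,
    show (1 / 2 / 2 : ℚ) = 1 / (2 * 2) by norm_num]
  field_simp
  ring

theorem eulerDerivFunctional_shift (p : ℚ[X]) :
    eulerDerivFunctional (p.comp (X + 1) + p.comp (X - 1)) = 2 * p.derivative.eval 0 := by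
  have h₁ := bernoulliFunctional_duplication (p.comp (C 2 * X))
  have h₂ := bernoulliFunctional_comp_X_add_one (p.comp (C 2 * X))
  have e₁ : (p.comp (X + 1)).comp (C 2 * X + C 1) = (p.comp (C 2 * X)).comp (X + 1) := by
    simp only [comp_assoc, add_comp, mul_comp, X_comp, C_comp, one_comp]
    congr 1
    simp only [C_ofNat, C_1]
    ring
  have e₂ : (p.comp (X - 1)).comp (C 2 * X + C 1) = p.comp (C 2 * X) := by
    simp [comp_assoc]
  have e₃ : (p.comp (X + 1)).comp (C 4 * X + C 1) = (p.comp (C 2 * X)).comp (C 2 * X + 1) := by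
    simp only [comp_assoc, add_comp, mul_comp, X_comp, C_comp, one_comp]
    congr 1
    simp only [C_ofNat, C_1]
    ring
  have e₄ : (p.comp (X - 1)).comp (C 4 * X + C 1) = (p.comp (C 2 * X)).comp (C 2 * X) := by
    simp only [comp_assoc, sub_comp, mul_comp, X_comp, C_comp, one_comp]
    congr 1
    simp only [C_ofNat, C_1]
    ring
  have hd : (p.comp (C 2 * X)).derivative.eval 0 = 2 * p.derivative.eval 0 := by
    simp [derivative_comp]
  rw [eulerDerivFunctional_apply, add_comp, add_comp, e₁, e₂, e₃, e₄, map_add, map_add]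
  linarith

/-- The monic polynomial with roots `1 ^ 2, 3 ^ 2, …, (2 * k - 1) ^ 2`. -/
noncomputable def oddSquaresPoly (k : ℕ) : ℚ[X] :=
  ∏ j ∈ Finset.range k, (X - C ((2 * j + 1 : ℚ) ^ 2))

theorem oddSquaresPoly_succ (k : ℕ) :
    oddSquaresPoly (k + 1) = oddSquaresPoly k * (X - C ((2 * k + 1 : ℚ) ^ 2)) :=
  Finset.prod_range_succ _ _

theorem oddSquaresPoly_monic (k : ℕ) : (oddSquaresPoly k).Monic :=
  monic_prod_of_monic _ _ fun _ _ => monic_X_sub_C _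

theorem natDegree_oddSquaresPoly (k : ℕ) : (oddSquaresPoly k).natDegree = k := by
  rw [oddSquaresPoly, natDegree_prod_of_monic _ _ fun _ _ => monic_X_sub_C _]
  simp only [natDegree_X_sub_C, Finset.sum_const, Finset.card_range, smul_eq_mul, mul_one]

/-- The monic polynomial with roots the even integers of absolute value at most `2 * k`. -/
noncomputable def evenRootsPoly (k : ℕ) : ℚ[X] :=
  X * ∏ j ∈ Finset.range k, (X ^ 2 - C ((2 * j + 2 : ℚ) ^ 2))

theorem evenRootsPoly_succ (k : ℕ) :
    evenRootsPoly (k + 1) = evenRootsPoly k * (X ^ 2 - C ((2 * k + 2 : ℚ) ^ 2)) := by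
  rw [evenRootsPoly, Finset.prod_range_succ, evenRootsPoly, mul_assoc]

theorem evenRootsPoly_comp_X_add_one (k : ℕ) :
    (evenRootsPoly k).comp (X + 1)
      = (X + C (2 * k + 1 : ℚ)) * (oddSquaresPoly k).comp (X ^ 2) := by
  induction k with
  | zero => simp [evenRootsPoly, oddSquaresPoly]
  | succ k ih =>
    rw [evenRootsPoly_succ, mul_comp, ih, oddSquaresPoly_succ, mul_comp]
    simp only [sub_comp, pow_comp, X_comp, C_comp]
    simp only [map_pow, map_add, map_mul, map_natCast, C_1, C_ofNat, Nat.cast_add, Nat.cast_one]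
    ring

theorem evenRootsPoly_comp_X_sub_one (k : ℕ) :
    (evenRootsPoly k).comp (X - 1)
      = (X - C (2 * k + 1 : ℚ)) * (oddSquaresPoly k).comp (X ^ 2) := by
  induction k with
  | zero => simp [evenRootsPoly, oddSquaresPoly]
  | succ k ih =>
    rw [evenRootsPoly_succ, mul_comp, ih, oddSquaresPoly_succ, mul_comp]
    simp only [sub_comp, pow_comp, X_comp, C_comp]
    simp only [map_pow, map_add, map_mul, map_natCast, C_1, C_ofNat, Nat.cast_add, Nat.cast_one]
    ring

theorem derivative_evenRootsPoly_eval_zero (k : ℕ) :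
    (evenRootsPoly k).derivative.eval 0 = (-4) ^ k * (k.factorial : ℚ) ^ 2 := by
  have h : (evenRootsPoly k).derivative.eval 0
      = ∏ j ∈ Finset.range k, (-(2 * j + 2 : ℚ) ^ 2) := by
    simp [evenRootsPoly, derivative_mul, eval_prod]
  rw [h]
  clear h
  induction k with
  | zero => simp
  | succ k ih =>
    rw [Finset.prod_range_succ, ih, Nat.factorial_succ]
    push_cast
    ring

/-- The linear functional on `ℚ[X]` sending `X ^ k` to `(2 * k + 1) * eulerNum (2 * k)`. -/
noncomputable def oddEulerFunctional : ℚ[X] →ₗ[ℚ] ℚ :=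
  eulerDerivFunctional ∘ₗ LinearMap.mulLeft ℚ X ∘ₗ (expand ℚ 2).toLinearMap

theorem oddEulerFunctional_apply (p : ℚ[X]) :
    oddEulerFunctional p = eulerDerivFunctional (X * p.comp (X ^ 2)) := by
  simp [oddEulerFunctional, expand_eq_comp_X_pow]

theorem oddEulerFunctional_X_pow (k : ℕ) :
    oddEulerFunctional (X ^ k) = (2 * (k : ℚ) + 1) * eulerNum (2 * k) := by
  rw [oddEulerFunctional_apply, X_pow_comp, ← pow_mul, ← pow_succ', eulerDerivFunctional_X_pow_succ]
  push_cast
  rfl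

theorem oddEulerFunctional_oddSquaresPoly (k : ℕ) :
    oddEulerFunctional (oddSquaresPoly k) = (-4) ^ k * (k.factorial : ℚ) ^ 2 := by
  have h := eulerDerivFunctional_shift (evenRootsPoly k)
  have e : (evenRootsPoly k).comp (X + 1) + (evenRootsPoly k).comp (X - 1)
      = (2 : ℚ) • (X * (oddSquaresPoly k).comp (X ^ 2)) := by
    rw [evenRootsPoly_comp_X_add_one, evenRootsPoly_comp_X_sub_one, smul_eq_C_mul, C_ofNat]
    ring
  rw [e, map_smul, smul_eq_mul, derivative_evenRootsPoly_eval_zero] at h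
  rw [oddEulerFunctional_apply]
  linarith

theorem oddEulerFunctional_oddSquaresPoly_mul (i j : ℕ) :
    oddEulerFunctional (oddSquaresPoly i * oddSquaresPoly j)
      = (-4) ^ (i + j) * (i + j).factorial * i.factorial * j.factorial := by
  induction j generalizing i with
  | zero =>
    have h := oddEulerFunctional_oddSquaresPoly i
    simp [oddSquaresPoly] at h ⊢
    rw [h]
    ring
  | succ j ih =>
    have e : oddSquaresPoly i * oddSquaresPoly (j + 1)
        = oddSquaresPoly (i + 1) * oddSquaresPoly j
          + ((2 * i + 1 : ℚ) ^ 2 - (2 * j + 1) ^ 2) • (oddSquaresPoly i * oddSquaresPoly j) := by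
      rw [oddSquaresPoly_succ, oddSquaresPoly_succ, smul_eq_C_mul, C_sub]
      ring
    rw [e, map_add, map_smul, ih, ih, smul_eq_mul, add_right_comm i 1 j, ← add_assoc i j 1,
      Nat.factorial_succ, Nat.factorial_succ, Nat.factorial_succ]
    push_cast
    ring

/-- A Hankel determinant of moments may be computed in any graded basis of monic polynomials. -/
theorem hankel_moments_eq_det {R : Type*} [CommRing R] [Nontrivial R] (L : R[X] →ₗ[R] R)
    (p : ℕ → R[X]) (hdeg : ∀ i, (p i).natDegree = i) (hmonic : ∀ i, (p i).Monic) (n : ℕ) :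
    hankel (fun k => L (X ^ k)) n
      = (Matrix.of fun i j : Fin (n + 1) => L (p i * p j)).det := by
  set P : Matrix (Fin (n + 1)) (Fin (n + 1)) R := Matrix.of fun i j => (p j).coeff i with hP
  have hdet : P.det = 1 :=
    Matrix.det_matrixOfPolynomials (fun i : Fin (n + 1) => p i) (fun i => hdeg i)
      (fun i => hmonic i)
  have expand_p (i : Fin (n + 1)) : p i = ∑ k : Fin (n + 1), (p i).coeff k • X ^ (k : ℕ) := by
    conv_lhs => rw [(p i).as_sum_range' (n + 1) (by rw [hdeg]; exact i.2)]
    rw [Finset.sum_range]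
    simp only [smul_X_eq_monomial]
  have hM : (Matrix.of fun i j : Fin (n + 1) => L (p i * p j))
      = P.transpose * (Matrix.of fun i j : Fin (n + 1) => L (X ^ (i.1 + j.1))) * P := by
    ext i j
    rw [Matrix.of_apply, expand_p i, expand_p j, Finset.sum_mul_sum, Finset.sum_comm,
      Matrix.mul_apply]
    simp only [map_sum, Matrix.mul_apply, Finset.sum_mul]
    refine Finset.sum_congr rfl fun k _ => Finset.sum_congr rfl fun l _ => ?_
    rw [smul_mul_smul_comm, ← pow_add, map_smul, smul_eq_mul, hP, Matrix.transpose_apply,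
      Matrix.of_apply, Matrix.of_apply, Matrix.of_apply]
    ring
  rw [hM, Matrix.det_mul, Matrix.det_mul, Matrix.det_transpose, hdet, hankel, one_mul, mul_one]

theorem add_choose_eq_sum_choose_mul_choose {i j n : ℕ} (hj : j ≤ n) :
    (i + j).choose j = ∑ k ∈ Finset.range (n + 1), i.choose k * j.choose k := by
  rw [Nat.add_choose_eq, Finset.Nat.sum_antidiagonal_eq_sum_range_succ_mk]
  refine (Finset.sum_congr rfl fun k hk => ?_).trans
    (Finset.sum_subset (Finset.range_mono (Nat.succ_le_succ hj)) fun k _ hk => ?_)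
  · rw [Nat.choose_symm (Finset.mem_range_succ_iff.mp hk)]
  · rw [Nat.choose_eq_zero_of_lt (n := j) (by simpa using hk), mul_zero]

theorem det_factorial_add_mul (n : ℕ) (a : ℕ → ℚ) :
    (Matrix.of fun i j : Fin (n + 1) => a i * a j * (i.1 + j.1).factorial).det
      = ∏ i ∈ Finset.range (n + 1), (a i * i.factorial) ^ 2 := by
  set A : Matrix (Fin (n + 1)) (Fin (n + 1)) ℚ :=
    Matrix.of fun i k => a i * (i.1.factorial : ℚ) * (i.1.choose k : ℚ) with hA
  have hdet : A.det = ∏ i : Fin (n + 1), (a i * i.1.factorial) := by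
    rw [Matrix.det_of_isLowerTriangular]
    · simp [hA]
    · intro i k hik
      have : i.1 < k.1 := hik
      simp [hA, Nat.choose_eq_zero_of_lt this]
  have hM : (Matrix.of fun i j : Fin (n + 1) => a i * a j * ((i.1 + j.1).factorial : ℚ))
      = A * A.transpose := by
    ext i j
    have h := add_choose_eq_sum_choose_mul_choose (i := i.1) (Nat.le_of_lt_succ j.2)
    rw [Finset.sum_range] at h
    have hf : ((i.1 + j.1).factorial : ℚ)
        = (i.1 + j.1).choose j * i.1.factorial * j.1.factorial := by
      exact_mod_cast (Nat.add_choose_mul_factorial_mul_factorial i.1 j.1).symm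
    rw [Matrix.of_apply, hf, h, Matrix.mul_apply]
    push_cast
    rw [Finset.sum_mul, Finset.sum_mul, Finset.mul_sum]
    refine Finset.sum_congr rfl fun k _ => ?_
    simp only [hA, Matrix.of_apply, Matrix.transpose_apply]
    ring
  rw [hM, Matrix.det_mul, Matrix.det_transpose, hdet, Finset.prod_range, Finset.prod_pow, sq]

theorem hankel_odd_times_euler (n : ℕ) :
    hankel (fun k => (2 * (k : ℚ) + 1) * eulerNum (2 * k)) n
      = 2 ^ (2 * n * (n + 1)) * ∏ ℓ ∈ Finset.Icc 1 n, (Nat.factorial ℓ : ℚ) ^ 4 := by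
  simp only [← oddEulerFunctional_X_pow]
  rw [hankel_moments_eq_det _ oddSquaresPoly natDegree_oddSquaresPoly oddSquaresPoly_monic]
  have h := det_factorial_add_mul n fun i => (-4 : ℚ) ^ i * i.factorial
  have e (i j : ℕ) : oddEulerFunctional (oddSquaresPoly i * oddSquaresPoly j)
      = (-4 : ℚ) ^ i * i.factorial * ((-4) ^ j * j.factorial) * (i + j).factorial := by
    rw [oddEulerFunctional_oddSquaresPoly_mul]
    ring
  simp only [e]
  rw [h]
  clear h e
  induction n with
  | zero => simp
  | succ n ih =>
    have h16 : ((-4 : ℚ) ^ (n + 1)) ^ 2 = 2 ^ (4 * (n + 1)) := by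
      rw [← pow_mul, mul_comm, pow_mul, pow_mul]
      norm_num
    rw [Finset.prod_range_succ, ih, Finset.prod_Icc_succ_top (by omega), mul_pow, mul_pow, h16]
    ring
end

section
/- For all n ≥ 0, the Hankel determinant of the sequence ((2k+1)·B_{2k}(1/2))_{k≥0} equals Π_{ℓ=1}^{n} (ℓ!)^8 / ((2ℓ)!(2ℓ+1)!), i.e., det_{0≤i,j≤n}((2(i+j)+1) B_{2(i+j)}(1/2)) = Π_{ℓ=1}^{n} (ℓ!)^8/((2ℓ)!(2ℓ+1)!). Equivalently, since B_{2k}(1/2) = (2^{1−2k} − 1)B_{2k}, this evaluates the Hankel determinant of ((2k+1)(2^{1−2k} − 1)B_{2k}). -/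
open Polynomial in
/-- The umbral functional of the Bernoulli numbers: the linear map sending `X ^ n` to `B_n`. -/
noncomputable def bernoulliUmbra : ℚ[X] →ₗ[ℚ] ℚ :=
  Polynomial.lsum fun n => _root_.bernoulli n • LinearMap.id

open Polynomial in
theorem bernoulliUmbra_monomial (n : ℕ) (a : ℚ) :
    bernoulliUmbra (monomial n a) = _root_.bernoulli n * a := by
  simp [bernoulliUmbra, Polynomial.lsum_apply, Polynomial.sum_monomial_index]

open Polynomial in
theorem bernoulliUmbra_X_add_C_pow (n : ℕ) (z : ℚ) :
    bernoulliUmbra ((X + C z) ^ n) = (Polynomial.bernoulli n).eval z := by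
  rw [add_pow, map_sum, Polynomial.bernoulli, eval_finsetSum]
  refine Finset.sum_congr rfl fun i _ => ?_
  have : (X : ℚ[X]) ^ i * C z ^ (n - i) * (n.choose i : ℚ[X])
      = monomial i (z ^ (n - i) * n.choose i) := by
    rw [← C_mul_X_pow_eq_monomial, C_mul, C_pow, C_eq_natCast]
    ring
  rw [this, bernoulliUmbra_monomial, eval_monomial]
  ring

open Polynomial in
theorem bernoulliUmbra_comp_X_add_one (p : ℚ[X]) :
    bernoulliUmbra (p.comp (X + 1)) = bernoulliUmbra p + (derivative p).eval 0 := by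
  induction p using Polynomial.induction_on' with
  | add p q hp hq =>
    rw [add_comp, map_add, map_add, hp, hq, derivative_add, eval_add]
    ring
  | monomial n a =>
    rw [monomial_comp, ← smul_eq_C_mul, map_smul, ← C_1, bernoulliUmbra_X_add_C_pow,
      bernoulliUmbra_monomial, derivative_monomial, eval_monomial, smul_eq_mul]
    have h := Polynomial.bernoulli_eval_one_add n 0
    rw [add_zero, Polynomial.bernoulli_eval_zero] at h
    rw [h]
    ring

open Polynomial in
/-- The linear functional on `ℚ[X]` with moments `(2k+1) B_{2k}(1/2)`. -/
noncomputable def oddBernoulliHalf : ℚ[X] →ₗ[ℚ] ℚ :=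
  bernoulliUmbra ∘ₗ derivative ∘ₗ LinearMap.mulLeft ℚ (X + C (1 / 2)) ∘ₗ
    (aeval ((X + C (1 / 2) : ℚ[X]) ^ 2)).toLinearMap

open Polynomial in
theorem oddBernoulliHalf_apply (f : ℚ[X]) :
    oddBernoulliHalf f
      = bernoulliUmbra (derivative ((X + C (1 / 2)) * aeval ((X + C (1 / 2) : ℚ[X]) ^ 2) f)) :=
  rfl

open Polynomial in
theorem oddBernoulliHalf_X_pow (k : ℕ) :
    oddBernoulliHalf (X ^ k) = (2 * (k : ℚ) + 1) * (Polynomial.bernoulli (2 * k)).eval (1 / 2) := by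
  have h : derivative ((X + C (1 / 2) : ℚ[X]) * aeval ((X + C (1 / 2) : ℚ[X]) ^ 2) (X ^ k : ℚ[X]))
      = (2 * (k : ℚ) + 1) • (X + C (1 / 2)) ^ (2 * k) := by
    rw [map_pow, aeval_X, ← pow_mul, ← pow_succ', derivative_X_add_C_pow, smul_eq_C_mul]
    simp
  rw [oddBernoulliHalf_apply, h, map_smul, bernoulliUmbra_X_add_C_pow, smul_eq_mul]

open Polynomial in
/-- The monic polynomial with roots `(j + 1/2)²` for `j < k`. -/
noncomputable def halfOddSquarePoly (k : ℕ) : ℚ[X] :=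
  ∏ j ∈ Finset.range k, (X - C (((j : ℚ) + 1 / 2) ^ 2))

open Polynomial in
theorem halfOddSquarePoly_monic (k : ℕ) : (halfOddSquarePoly k).Monic :=
  monic_prod_of_monic _ _ fun _ _ => monic_X_sub_C _

open Polynomial in
theorem halfOddSquarePoly_natDegree (k : ℕ) : (halfOddSquarePoly k).natDegree = k := by
  rw [halfOddSquarePoly, natDegree_prod_of_monic _ _ fun _ _ => monic_X_sub_C _]
  simp only [natDegree_X_sub_C]
  simp

open Polynomial in
theorem aeval_halfOddSquarePoly (k : ℕ) :
    aeval ((X + C (1 / 2) : ℚ[X]) ^ 2) (halfOddSquarePoly k)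
      = ∏ j ∈ Finset.range k, ((X - C (j : ℚ)) * (X + C (j : ℚ) + 1)) := by
  rw [halfOddSquarePoly, map_prod]
  refine Finset.prod_congr rfl fun j _ => ?_
  have h : (C (1 / 2) : ℚ[X]) * 2 = 1 := by
    rw [← C_ofNat, ← C_mul, ← C_1]
    norm_num
  rw [map_sub, aeval_X, aeval_C, algebraMap_eq, C_pow, C_add]
  linear_combination (X - C (j : ℚ)) * h

open Polynomial in
theorem X_mul_prod_X_sq_sub_sq (k : ℕ) :
    X * ∏ i ∈ Finset.range k, ((X : ℚ[X]) ^ 2 - C ((i : ℚ) + 1) ^ 2)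
      = (X - C (k : ℚ)) * ∏ j ∈ Finset.range k, ((X - C (j : ℚ)) * (X + C (j : ℚ) + 1)) := by
  induction k with
  | zero => simp
  | succ k ih =>
    rw [Finset.prod_range_succ, Finset.prod_range_succ, ← mul_assoc, ih, C_add, C_1]
    push_cast
    rw [C_add, C_1]
    ring

open Polynomial in
theorem X_add_one_mul_prod_X_add_one_sq_sub_sq (k : ℕ) :
    (X + 1) * ∏ i ∈ Finset.range k, ((X + 1 : ℚ[X]) ^ 2 - C ((i : ℚ) + 1) ^ 2)
      = (X + C (k : ℚ) + 1) *
        ∏ j ∈ Finset.range k, ((X - C (j : ℚ)) * (X + C (j : ℚ) + 1)) := by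
  induction k with
  | zero => simp
  | succ k ih =>
    rw [Finset.prod_range_succ, Finset.prod_range_succ, ← mul_assoc, ih, C_add, C_1]
    push_cast
    rw [C_add, C_1]
    ring

theorem prod_range_neg_succ_sq (k : ℕ) :
    ∏ i ∈ Finset.range k, (-((i : ℚ) + 1) ^ 2) = (-1) ^ k * (k.factorial : ℚ) ^ 2 := by
  induction k with
  | zero => simp
  | succ k ih =>
    rw [Finset.prod_range_succ, ih, Nat.factorial_succ]
    push_cast
    ring

open Polynomial in
theorem oddBernoulliHalf_halfOddSquarePoly (k : ℕ) :
    oddBernoulliHalf (halfOddSquarePoly k)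
      = (-1) ^ k * (k.factorial : ℚ) ^ 2 / ((k : ℚ) + 1) := by
  set S : ℚ[X] := ∏ i ∈ Finset.range k, (X ^ 2 - C ((i : ℚ) + 1) ^ 2) with hS
  set Q : ℚ[X] := C (1 / (2 * ((k : ℚ) + 1))) * (X ^ 2 * S) with hQ
  have hk : (k : ℚ) + 1 ≠ 0 := by positivity
  have hcomp : Q.comp (X + 1) - Q
      = (X + C (1 / 2)) * aeval ((X + C (1 / 2) : ℚ[X]) ^ 2) (halfOddSquarePoly k) := by
    have h1 := X_mul_prod_X_sq_sub_sq k
    have h2 := X_add_one_mul_prod_X_add_one_sq_sub_sq k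
    rw [← aeval_halfOddSquarePoly] at h1 h2
    have hSc : S.comp (X + 1)
        = ∏ i ∈ Finset.range k, ((X + 1 : ℚ[X]) ^ 2 - C ((i : ℚ) + 1) ^ 2) := by
      rw [hS, prod_comp]
      simp
    have h3 : (C (1 / (2 * ((k : ℚ) + 1))) : ℚ[X]) * (C (k : ℚ) + 1) = C (1 / 2) := by
      rw [← C_1, ← C_add, ← C_mul]
      congr 1
      field_simp
    have h4 : (C (1 / 2) : ℚ[X]) * 2 = 1 := by
      rw [← C_ofNat, ← C_mul, ← C_1]
      norm_num
    rw [hQ, mul_comp, mul_comp, hSc, C_comp, X_pow_comp]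
    rw [← hS] at h1
    set P := aeval ((X + C (1 / 2) : ℚ[X]) ^ 2) (halfOddSquarePoly k)
    linear_combination C (1 / (2 * ((k : ℚ) + 1))) * ((X + 1) * h2 - X * h1)
      + (2 * X + 1) * P * h3 + X * P * h4
  have hderiv : (derivative (derivative Q)).eval 0
      = (-1) ^ k * (k.factorial : ℚ) ^ 2 / ((k : ℚ) + 1) := by
    have hS0 : S.eval 0 = (-1) ^ k * (k.factorial : ℚ) ^ 2 := by
      rw [← prod_range_neg_succ_sq, hS, eval_prod]
      simp
    simp only [hQ, derivative_mul, derivative_C, derivative_X_pow, derivative_add, eval_add,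
      eval_mul, eval_C, eval_pow, eval_X, hS0]
    simp
    field_simp
  have hshift := bernoulliUmbra_comp_X_add_one (derivative Q)
  have hdc : derivative (Q.comp (X + 1)) = (derivative Q).comp (X + 1) := by
    rw [derivative_comp]
    simp
  rw [oddBernoulliHalf_apply, ← hcomp, derivative_sub, map_sub, hdc, hshift, hderiv]
  ring

theorem oddBernoulliHalf_halfOddSquarePoly_mul (j k : ℕ) :
    oddBernoulliHalf (halfOddSquarePoly j * halfOddSquarePoly k)
      = ((-1) ^ j * (j.factorial : ℚ) ^ 2) *
        (((-1) ^ k * (k.factorial : ℚ) ^ 2) * (1 / ((j : ℚ) + k + 1))) := by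
  induction j generalizing k with
  | zero =>
    rw [show halfOddSquarePoly 0 = 1 by simp [halfOddSquarePoly], one_mul,
      oddBernoulliHalf_halfOddSquarePoly]
    simp [div_eq_mul_inv]
  | succ j ih =>
    have h : halfOddSquarePoly (j + 1) * halfOddSquarePoly k
        = halfOddSquarePoly j * halfOddSquarePoly (k + 1)
          + (((k : ℚ) + 1 / 2) ^ 2 - ((j : ℚ) + 1 / 2) ^ 2) •
            (halfOddSquarePoly j * halfOddSquarePoly k) := by
      simp only [halfOddSquarePoly, Finset.prod_range_succ, Polynomial.smul_eq_C_mul,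
        Polynomial.C_sub]
      ring
    rw [h, map_add, map_smul, ih, ih, smul_eq_mul, Nat.factorial_succ, Nat.factorial_succ]
    push_cast
    have h1 : (j : ℚ) + k + 1 ≠ 0 := by positivity
    have h2 : (j : ℚ) + (k + 1) + 1 ≠ 0 := by positivity
    have h3 : (j : ℚ) + 1 + k + 1 ≠ 0 := by positivity
    field_simp
    ring

open Polynomial in
/-- The Gram matrix of a linear functional in any monic graded basis has the same determinant as
its Hankel matrix of moments. -/
theorem hankel_eq_det_monic {R : Type*} [CommRing R] (L : R[X] →ₗ[R] R) (p : ℕ → R[X])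
    (hdeg : ∀ i, (p i).natDegree = i) (hmonic : ∀ i, (p i).Monic) (n : ℕ) :
    hankel (fun k => L (X ^ k)) n
      = (Matrix.of fun i j : Fin (n + 1) => L (p i * p j)).det := by
  set A : Matrix (Fin (n + 1)) (Fin (n + 1)) R := Matrix.of fun i j => (p j).coeff i with hA
  have hdet : A.det = 1 :=
    Matrix.det_matrixOfPolynomials (fun i : Fin (n + 1) => p i) (fun i => hdeg i)
      (fun i => hmonic i)
  have hexp (i : Fin (n + 1)) : p i = ∑ a : Fin (n + 1), (p i).coeff a • X ^ (a : ℕ) := by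
    rw [Fin.sum_univ_eq_sum_range (fun a => (p i).coeff a • (X : R[X]) ^ a)]
    simp only [smul_eq_C_mul]
    exact as_sum_range_C_mul_X_pow' (p i) (by rw [hdeg]; exact i.2)
  have hmat : (Matrix.of fun i j : Fin (n + 1) => L (p i * p j))
      = A.transpose * (Matrix.of fun i j : Fin (n + 1) => L (X ^ (i.1 + j.1))) * A := by
    ext i j
    rw [Matrix.of_apply, hexp i, hexp j, Finset.sum_mul_sum, Finset.sum_comm, map_sum]
    simp only [Matrix.mul_apply, hA, Matrix.of_apply, Matrix.transpose_apply, map_sum,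
      Finset.sum_mul]
    refine Finset.sum_congr rfl fun b _ => Finset.sum_congr rfl fun a _ => ?_
    rw [smul_mul_smul_comm, ← pow_add, map_smul, smul_eq_mul]
    ring
  rw [hmat, Matrix.det_mul, Matrix.det_mul, Matrix.det_transpose, hdet, hankel]
  ring

theorem prod_sub_div_add (n : ℕ) :
    ∏ i : Fin n, (((n : ℚ) - i) / ((i : ℚ) + n + 1))
      = (n.factorial : ℚ) ^ 2 / ((2 * n).factorial : ℚ) := by
  have hnum : ∏ i : Fin n, ((n : ℚ) - i) = n.factorial := by
    rw [Fin.prod_univ_eq_prod_range (fun i => (n : ℚ) - i), ← Finset.prod_range_reflect,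
      ← Finset.prod_range_add_one_eq_factorial]
    push_cast
    refine Finset.prod_congr rfl fun i hi => ?_
    have hi := Finset.mem_range.1 hi
    rw [Nat.sub_sub, Nat.cast_sub (by omega)]
    push_cast
    ring
  have hden : (n.factorial : ℚ) * ∏ i : Fin n, ((i : ℚ) + n + 1) = (2 * n).factorial := by
    rw [Fin.prod_univ_eq_prod_range (fun i => (i : ℚ) + n + 1), two_mul,
      ← Nat.factorial_mul_ascFactorial, Nat.ascFactorial_eq_prod_range]
    push_cast
    congr 1
    refine Finset.prod_congr rfl fun i _ => ?_
    ring
  have hn : (n.factorial : ℚ) ≠ 0 := by positivity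
  have hprod : ∏ i : Fin n, ((i : ℚ) + n + 1) ≠ 0 :=
    Finset.prod_ne_zero_iff.2 fun i _ => by positivity
  rw [Finset.prod_div_distrib, hnum, ← hden]
  field_simp

/-- The recursion for the determinants of the Hilbert matrices. -/
theorem det_hilbert_succ (n : ℕ) :
    (Matrix.of fun i j : Fin (n + 1) => 1 / ((i : ℚ) + j + 1)).det
      = (n.factorial : ℚ) ^ 4 / (((2 * n).factorial : ℚ) * ((2 * n + 1).factorial : ℚ))
        * (Matrix.of fun i j : Fin n => 1 / ((i : ℚ) + j + 1)).det := by
  set A : Matrix (Fin (n + 1)) (Fin (n + 1)) ℚ :=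
    Matrix.of fun i j => 1 / ((i : ℚ) + j + 1) with hA
  set c : Fin (n + 1) → ℚ :=
    fun i => if i = Fin.last n then 0 else (2 * (n : ℚ) + 1) / ((i : ℚ) + n + 1) with hc
  set B : Matrix (Fin (n + 1)) (Fin (n + 1)) ℚ :=
    Matrix.of fun i j => A i j - c i * A (Fin.last n) j with hB
  have hlast : c (Fin.last n) = 0 := by simp [hc]
  have hAB : A.det = B.det :=
    Matrix.det_eq_of_forall_row_eq_smul_add_const c (Fin.last n) hlast fun i j => by
      simp [hB, hlast]
  have hzero (i : Fin n) : B i.castSucc (Fin.last n) = 0 := by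
    have h1 : (i : ℚ) + n + 1 ≠ 0 := by positivity
    have h2 : (n : ℚ) + n + 1 ≠ 0 := by positivity
    simp only [hB, hA, hc, Matrix.of_apply, Fin.val_castSucc, Fin.val_last,
      (Fin.castSucc_lt_last i).ne, if_false]
    field_simp
    ring
  have hcorner : B (Fin.last n) (Fin.last n) = 1 / (2 * (n : ℚ) + 1) := by
    simp only [hB, hA, hlast, Matrix.of_apply, Fin.val_last]
    ring
  have hminor : B.submatrix Fin.castSucc Fin.castSucc
      = Matrix.of fun i j : Fin n => ((n : ℚ) - i) / ((i : ℚ) + n + 1) *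
        (Matrix.of fun i j : Fin n => ((n : ℚ) - j) / ((j : ℚ) + n + 1) *
          (Matrix.of fun i j : Fin n => 1 / ((i : ℚ) + j + 1)) i j) i j := by
    ext i j
    have h1 : (i : ℚ) + n + 1 ≠ 0 := by positivity
    have h2 : (j : ℚ) + n + 1 ≠ 0 := by positivity
    have h3 : (n : ℚ) + j + 1 ≠ 0 := by positivity
    have h4 : (i : ℚ) + j + 1 ≠ 0 := by positivity
    simp only [hB, hA, hc, Matrix.submatrix_apply, Matrix.of_apply, Fin.val_castSucc,
      Fin.val_last, (Fin.castSucc_lt_last i).ne, if_false]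
    field_simp
    ring
  rw [hAB, Matrix.det_succ_column B (Fin.last n), Fin.sum_univ_castSucc,
    Finset.sum_eq_zero fun i _ => by rw [hzero]; ring, hcorner, Fin.succAbove_last, hminor,
    Matrix.det_mul_column, Matrix.det_mul_row, prod_sub_div_add, Nat.factorial_succ (2 * n),
    Fin.val_last, Even.neg_one_pow ⟨n, rfl⟩]
  have h1 : ((2 * n).factorial : ℚ) ≠ 0 := by positivity
  have h2 : (2 * (n : ℚ) + 1) ≠ 0 := by positivity
  push_cast
  field_simp
  ring

theorem det_hilbert (n : ℕ) :
    (Matrix.of fun i j : Fin (n + 1) => 1 / ((i : ℚ) + j + 1)).det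
      = ∏ ℓ ∈ Finset.Icc 1 n,
          (ℓ.factorial : ℚ) ^ 4 / (((2 * ℓ).factorial : ℚ) * ((2 * ℓ + 1).factorial : ℚ)) := by
  induction n with
  | zero => simp
  | succ n ih => rw [det_hilbert_succ, ih, Finset.prod_Icc_succ_top (by omega), mul_comm]

theorem hankel_odd_times_bernoulli_half (n : ℕ) :
    hankel (fun k => (2 * (k : ℚ) + 1) * (Polynomial.bernoulli (2 * k)).eval (1 / 2)) n
      = ∏ ℓ ∈ Finset.Icc 1 n,
          (Nat.factorial ℓ : ℚ) ^ 8
            / ((Nat.factorial (2 * ℓ) : ℚ) * (Nat.factorial (2 * ℓ + 1) : ℚ)) := by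
  simp_rw [← oddBernoulliHalf_X_pow]
  rw [hankel_eq_det_monic oddBernoulliHalf halfOddSquarePoly halfOddSquarePoly_natDegree
    halfOddSquarePoly_monic]
  simp_rw [oddBernoulliHalf_halfOddSquarePoly_mul]
  have hcol := Matrix.det_mul_column
    (fun i : Fin (n + 1) => (-1 : ℚ) ^ (i : ℕ) * ((i : ℕ).factorial : ℚ) ^ 2)
    (Matrix.of fun i j : Fin (n + 1) => (-1 : ℚ) ^ (j : ℕ) * ((j : ℕ).factorial : ℚ) ^ 2 *
      (Matrix.of fun i j : Fin (n + 1) => 1 / ((i : ℚ) + j + 1)) i j)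
  rw [Matrix.det_mul_row] at hcol
  refine hcol.trans ?_
  rw [det_hilbert, Fin.prod_univ_eq_prod_range (fun i => (-1 : ℚ) ^ i * (i.factorial : ℚ) ^ 2)]
  clear hcol
  induction n with
  | zero => simp
  | succ n ih =>
    have hsign : ((-1 : ℚ) ^ (n + 1)) ^ 2 = 1 := by rw [← pow_mul, mul_comm, pow_mul]; simp
    rw [Finset.prod_range_succ, Finset.prod_Icc_succ_top (by omega),
      Finset.prod_Icc_succ_top (by omega), ← ih]
    generalize (-1 : ℚ) ^ (n + 1) = s at hsign ⊢
    generalize ∏ i ∈ Finset.range (n + 1), (-1 : ℚ) ^ i * (i.factorial : ℚ) ^ 2 = D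
    generalize ∏ ℓ ∈ Finset.Icc 1 n,
      (ℓ.factorial : ℚ) ^ 4 / (((2 * ℓ).factorial : ℚ) * ((2 * ℓ + 1).factorial : ℚ)) = H
    linear_combination D * (D * H) * (((n + 1).factorial : ℚ) ^ 8
      / (((2 * (n + 1)).factorial : ℚ) * ((2 * (n + 1) + 1).factorial : ℚ))) * hsign
end
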